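/- arXiv:2509.16162 — 2 statements merged into one kernel-verified Lean document; each statement's English description precedes it below -/
import Mathlib

section
/- For every n ≥ 1 the function τ_n(p) = ℙ(E_n(p)) is differentiable on [0,1) and its derivative satisfies dτ_n(p)/dp = (1/(1−p)) · Σ_{e∈𝓔} ℙ(e is p-pivotal for E_n(p)). -/
open MeasureTheory

namespace CDP

/-- Vertices of the hypercubic lattice `ℤ^d`. -/
abbrev Vertex (d : ℕ) := Fin d → ℤ

/-- Nearest-neighbour adjacency in `ℤ^d`. -/
def adj {d : ℕ} (x y : Vertex d) : Prop := (∑ i, |x i - y i|) = 1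

/-- `e` is a nearest-neighbour (non-oriented) edge of `ℤ^d`, i.e. an element of `𝓔`. -/
def IsNNEdge {d : ℕ} (e : Sym2 (Vertex d)) : Prop := ∃ x y, adj x y ∧ e = s(x, y)

/-- Configurations: labels attached to (unordered) pairs of vertices; only the labels of
nearest-neighbour edges (elements of `𝓔`) are ever relevant. -/
abbrev Config (d : ℕ) := Sym2 (Vertex d) → ℝ

/-- `ℓ^1` norm of a vertex. -/
def norm1 {d : ℕ} (x : Vertex d) : ℤ := ∑ i, |x i|

/-- The set `Ω`: configurations with values in `[0,1]`, pairwise distinct coordinates on `𝓔`,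
and no infinite walk along which the labels are strictly monotone. -/
def goodConfigs (d : ℕ) : Set (Config d) :=
  {U | (∀ e, IsNNEdge e → U e ∈ Set.Icc (0 : ℝ) 1) ∧
    (∀ e f, IsNNEdge e → IsNNEdge f → U e = U f → e = f) ∧
    ¬ ∃ w : ℕ → Vertex d, (∀ i, adj (w i) (w (i + 1))) ∧
      (StrictMono (fun i => U s(w i, w (i + 1))) ∨ StrictAnti (fun i => U s(w i, w (i + 1))))}

/-- A labelling `σ` of the edges by "ever opens" which is consistent with the
constrained-degree dynamics driven by `U`: an edge (attempting to open at time `U e`)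
opens iff at that moment both of its end-vertices have degree `< κ` among the
previously opened edges. -/
def Consistent {d : ℕ} (κ : ℕ) (U : Config d) (σ : Sym2 (Vertex d) → Prop) : Prop :=
  ∀ e, IsNNEdge e →
    (σ e ↔ ∀ v ∈ e,
      Set.ncard {f : Sym2 (Vertex d) | IsNNEdge f ∧ v ∈ f ∧ f ≠ e ∧ U f < U e ∧ σ f} < κ)

/-- `ω_p(U, e) = 1`, i.e. the edge `e` is `p`-open in the constrained-degree percolation
process with constraint `κ` driven by `U`. -/
def openEdge {d : ℕ} (κ : ℕ) (U : Config d) (p : ℝ) (e : Sym2 (Vertex d)) : Prop :=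
  IsNNEdge e ∧ U e ≤ p ∧ ∃ σ, Consistent κ U σ ∧ σ e

/-- `x 0, …, x k` is a path: consecutive vertices adjacent, all vertices distinct. -/
def IsPathOn {d : ℕ} (k : ℕ) (x : ℕ → Vertex d) : Prop :=
  (∀ i < k, adj (x i) (x (i + 1))) ∧ ∀ i ≤ k, ∀ j ≤ k, x i = x j → i = j

/-- The modified one-arm event `E_n(p)`: a path `x_0, …, x_k` with `‖x_0‖₁ = n`,
`‖x_i‖₁ < n` for `1 ≤ i ≤ k`, `x_k = 0`, whose head consists of `p`-open edges and whose
tail is decreasing (values `≤ p`, strictly decreasing towards the origin). -/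
def modifiedOneArm {d : ℕ} (κ n : ℕ) (p : ℝ) (U : Config d) : Prop :=
  ∃ (k : ℕ) (x : ℕ → Vertex d),
    IsPathOn k x ∧ norm1 (x 0) = (n : ℤ) ∧ (∀ i, 1 ≤ i → i ≤ k → norm1 (x i) < (n : ℤ)) ∧
    x k = 0 ∧
    ∃ l ≤ k,
      (∀ i < l, openEdge κ U p s(x i, x (i + 1))) ∧
      (∀ i, l ≤ i → i < k → U s(x i, x (i + 1)) ≤ p) ∧
      (∀ i, l ≤ i → i + 1 < k → U s(x (i + 1), x (i + 2)) < U s(x i, x (i + 1)))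

/-- `a` and `b` are connected by a `p`-open path. -/
def openConn {d : ℕ} (κ : ℕ) (U : Config d) (p : ℝ) (a b : Vertex d) : Prop :=
  ∃ (k : ℕ) (x : ℕ → Vertex d), IsPathOn k x ∧ x 0 = a ∧ x k = b ∧
    ∀ i < k, openEdge κ U p s(x i, x (i + 1))

/-- There is an infinite `p`-open path starting at the origin. -/
def zeroToInf {d : ℕ} (κ : ℕ) (U : Config d) (p : ℝ) : Prop :=
  ∃ x : ℕ → Vertex d, x 0 = 0 ∧ (∀ i, adj (x i) (x (i + 1))) ∧ Function.Injective x ∧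
    ∀ i, openEdge κ U p s(x i, x (i + 1))

/-- `P` is the law of i.i.d. `Uniform[0,1]` labels: a probability measure whose
finite-dimensional cylinder probabilities are products of uniform probabilities. -/
def IsProductUniform {d : ℕ} (P : Measure (Config d)) : Prop :=
  IsProbabilityMeasure P ∧
    ∀ (s : Finset (Sym2 (Vertex d))) (f : Sym2 (Vertex d) → Set ℝ),
      (∀ e ∈ s, MeasurableSet (f e)) →
      P {U | ∀ e ∈ s, U e ∈ f e} = ∏ e ∈ s, volume (f e ∩ Set.Icc 0 1)

/-- The one-arm probability `θ_n(p)`. -/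
noncomputable def theta {d : ℕ} (κ : ℕ) (P : Measure (Config d)) (n : ℕ) (p : ℝ) : ℝ :=
  (P {U | U ∈ goodConfigs d ∧ ∃ b, norm1 b = (n : ℤ) ∧ openConn κ U p 0 b}).toReal

/-- `θ(p) = ℙ(0 ↔ ∞)`. -/
noncomputable def thetaInf {d : ℕ} (κ : ℕ) (P : Measure (Config d)) (p : ℝ) : ℝ :=
  (P {U | U ∈ goodConfigs d ∧ zeroToInf κ U p}).toReal

/-- The critical point `p_c`. -/
noncomputable def pc {d : ℕ} (κ : ℕ) (P : Measure (Config d)) : ℝ :=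
  sSup {p : ℝ | p ∈ Set.Icc (0 : ℝ) 1 ∧ thetaInf κ P p = 0}

/-- The modified one-arm probability `τ_n(p)`. -/
noncomputable def tau {d : ℕ} (κ : ℕ) (P : Measure (Config d)) (n : ℕ) (p : ℝ) : ℝ :=
  (P {U | U ∈ goodConfigs d ∧ modifiedOneArm κ n p U}).toReal

/-- `e` is `p`-pivotal for `E_n(p)` at `U`. -/
def pPivotal {d : ℕ} (κ n : ℕ) (p : ℝ) (e : Sym2 (Vertex d)) (U : Config d) : Prop :=
  U ∈ goodConfigs d ∧ p < U e ∧ Function.update U e p ∈ goodConfigs d ∧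
    ¬ (modifiedOneArm κ n p U ↔ modifiedOneArm κ n p (Function.update U e p))

/-- `e` is `U`-pivotal for `E_n(p)` at `U`. -/
def uPivotal {d : ℕ} (κ n : ℕ) (p : ℝ) (e : Sym2 (Vertex d)) (U : Config d) : Prop :=
  U ∈ goodConfigs d ∧ ∃ U' ∈ goodConfigs d, (∀ f, f ≠ e → U' f = U f) ∧
    ¬ (modifiedOneArm κ n p U ↔ modifiedOneArm κ n p U')

section

variable {d : ℕ} {κ n : ℕ}

/-- Two lattice edges touch when they share an end-vertex. -/
def touch (f e : Sym2 (Vertex d)) : Prop :=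
  IsNNEdge f ∧ IsNNEdge e ∧ ∃ v, v ∈ f ∧ v ∈ e

/-- `f` touches `e` and carries a smaller label. -/
def earlier (U : Config d) (f e : Sym2 (Vertex d)) : Prop := touch f e ∧ U f < U e

/-- A regularity condition which implies membership in `goodConfigs`, has full probability, and is
stable under changing a single label: it forbids infinite monotone chains of touching edges. -/
structure Regular (U : Config d) : Prop where
  mem_Icc : ∀ e, IsNNEdge e → U e ∈ Set.Icc (0 : ℝ) 1
  inj : ∀ e f, IsNNEdge e → IsNNEdge f → U e = U f → e = f
  wf : WellFounded (earlier U)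
  wf_neg : WellFounded (earlier (-U))

theorem touch_walk {w : ℕ → Vertex d} {i : ℕ} (h : adj (w i) (w (i + 1)))
    (h' : adj (w (i + 1)) (w (i + 2))) :
    touch s(w i, w (i + 1)) s(w (i + 1), w (i + 2)) :=
  ⟨⟨_, _, h, rfl⟩, ⟨_, _, h', rfl⟩, w (i + 1), by simp, by simp⟩

theorem touch.symm {e f : Sym2 (Vertex d)} (h : touch f e) : touch e f :=
  let ⟨a, b, v, c, c'⟩ := h
  ⟨b, a, v, c', c⟩

theorem Regular.mem_goodConfigs {U : Config d} (h : Regular U) : U ∈ goodConfigs d := by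
  refine ⟨h.mem_Icc, h.inj, ?_⟩
  rintro ⟨w, hw, hmono | hanti⟩
  · refine (wellFounded_iff_isEmpty_descending_chain.1 h.wf_neg).false
      ⟨fun i => s(w i, w (i + 1)), fun i => ⟨(touch_walk (hw i) (hw (i + 1))).symm, ?_⟩⟩
    simpa using hmono (Nat.lt_succ_self i)
  · exact (wellFounded_iff_isEmpty_descending_chain.1 h.wf).false
      ⟨fun i => s(w i, w (i + 1)), fun i => ⟨(touch_walk (hw i) (hw (i + 1))).symm,
        hanti (Nat.lt_succ_self i)⟩⟩

theorem wellFounded_earlier_update {U : Config d} (h : WellFounded (earlier U))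
    (e : Sym2 (Vertex d)) (q : ℝ) : WellFounded (earlier (Function.update U e q)) := by
  rw [wellFounded_iff_isEmpty_descending_chain] at h ⊢
  refine ⟨fun ⟨w, hw⟩ => ?_⟩
  have hanti : StrictAnti fun i => Function.update U e q (w i) :=
    strictAnti_nat_of_succ_lt fun i => (hw i).2
  obtain ⟨N, hN⟩ : ∃ N, ∀ i, w (N + i) ≠ e := by
    by_cases hex : ∃ j, w j = e
    · obtain ⟨j, hj⟩ := hex
      refine ⟨j + 1, fun i hi => ?_⟩
      have := hanti (show j < j + 1 + i by omega)
      simp [hi, hj] at this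
    · exact ⟨0, fun i hi => hex ⟨_, hi⟩⟩
  refine h.false ⟨fun i => w (N + i), fun i => ⟨(hw (N + i)).1, ?_⟩⟩
  have := (hw (N + i)).2
  rwa [Function.update_of_ne (hN i),
    Function.update_of_ne (show w (N + i + 1) ≠ e from hN (i + 1))] at this

theorem Regular.update {U : Config d} (h : Regular U) {e : Sym2 (Vertex d)} {q : ℝ}
    (hq : q ∈ Set.Icc (0 : ℝ) 1) (hne : ∀ f, IsNNEdge f → U f ≠ q) :
    Regular (Function.update U e q) where
  mem_Icc f hf := by
    by_cases hfe : f = e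
    · simpa [hfe] using hq
    · simpa [hfe] using h.mem_Icc f hf
  inj f g hf hg hfg := by
    by_cases hfe : f = e <;> by_cases hge : g = e
    · rw [hfe, hge]
    · subst hfe
      simp only [Function.update_self, Function.update_of_ne hge] at hfg
      exact absurd hfg.symm (hne g hg)
    · subst hge
      simp only [Function.update_self, Function.update_of_ne hfe] at hfg
      exact absurd hfg (hne f hf)
    · rw [Function.update_of_ne hfe, Function.update_of_ne hge] at hfg
      exact h.inj f g hf hg hfg
  wf := wellFounded_earlier_update h.wf e q
  wf_neg := by
    have : -Function.update U e q = Function.update (-U) e (-q) := by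
      funext f
      by_cases hfe : f = e
      · simp [hfe]
      · simp [hfe]
    rw [this]
    exact wellFounded_earlier_update h.wf_neg e (-q)

/-- A finite set containing every lattice edge incident to `v`. -/
noncomputable def edgesAt (v : Vertex d) : Finset (Sym2 (Vertex d)) := by
  classical exact (Finset.Icc (-1 : Vertex d) 1).image fun u => s(v, v + u)

theorem adj.symm {x y : Vertex d} (h : adj x y) : adj y x := by
  unfold adj at *
  rw [← h]
  exact Finset.sum_congr rfl fun i _ => abs_sub_comm _ _

theorem mem_edgesAt {v : Vertex d} {e : Sym2 (Vertex d)} (he : IsNNEdge e) (hv : v ∈ e) :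
    e ∈ edgesAt v := by
  have key : ∀ y, adj v y → s(v, y) ∈ edgesAt v := by
    intro y hy
    rw [edgesAt, Finset.mem_image]
    refine ⟨y - v, ?_, by simp⟩
    have hi : ∀ i, |v i - y i| ≤ 1 := fun i => by
      rw [← hy]
      exact Finset.single_le_sum (f := fun i => |v i - y i|) (fun _ _ => abs_nonneg _)
        (Finset.mem_univ i)
    rw [Finset.mem_Icc]
    constructor <;> intro i <;> have := abs_le.1 (hi i) <;> simp <;> omega
  obtain ⟨x, y, hxy, rfl⟩ := he
  rcases Sym2.mem_iff.1 hv with rfl | rfl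
  · exact key y hxy
  · rw [Sym2.eq_swap]
    exact key x hxy.symm

theorem finite_incident (v : Vertex d) : {f : Sym2 (Vertex d) | IsNNEdge f ∧ v ∈ f}.Finite :=
  (edgesAt v).finite_toSet.subset fun _ hf => mem_edgesAt hf.1 hf.2

/-- Iterated approximations of the final state of the dynamics driven by `U`. -/
def stage (κ : ℕ) (U : Config d) : ℕ → Sym2 (Vertex d) → Prop
  | 0, _ => False
  | k + 1, e => ∀ v ∈ e,
      Set.ncard {f : Sym2 (Vertex d) | IsNNEdge f ∧ v ∈ f ∧ f ≠ e ∧ U f < U e ∧ stage κ U k f} < κ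

/-- The edge `e` eventually opens in the dynamics driven by `U`. -/
def everOpen (κ : ℕ) (U : Config d) (e : Sym2 (Vertex d)) : Prop := ∃ K, ∀ k ≥ K, stage κ U k e

theorem finite_earlier (U : Config d) (e : Sym2 (Vertex d)) : {f | earlier U f e}.Finite := by
  induction e with
  | _ x y =>
    refine ((finite_incident x).union (finite_incident y)).subset ?_
    rintro f ⟨⟨hf, -, v, hv, hve⟩, -⟩
    rcases Sym2.mem_iff.1 hve with rfl | rfl
    · exact Or.inl ⟨hf, hv⟩
    · exact Or.inr ⟨hf, hv⟩

theorem setOf_smaller_congr {U : Config d} {e : Sym2 (Vertex d)} {v : Vertex d} (he : IsNNEdge e)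
    (hv : v ∈ e) {σ σ' : Sym2 (Vertex d) → Prop} (h : ∀ f, earlier U f e → (σ f ↔ σ' f)) :
    {f : Sym2 (Vertex d) | IsNNEdge f ∧ v ∈ f ∧ f ≠ e ∧ U f < U e ∧ σ f} =
      {f | IsNNEdge f ∧ v ∈ f ∧ f ≠ e ∧ U f < U e ∧ σ' f} := by
  ext f
  constructor
  · rintro ⟨h1, h2, h3, h4, h5⟩
    exact ⟨h1, h2, h3, h4, (h f ⟨⟨h1, he, v, h2, hv⟩, h4⟩).1 h5⟩
  · rintro ⟨h1, h2, h3, h4, h5⟩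
    exact ⟨h1, h2, h3, h4, (h f ⟨⟨h1, he, v, h2, hv⟩, h4⟩).2 h5⟩

theorem stage_eventually_const {U : Config d} (h : WellFounded (earlier U)) (e : Sym2 (Vertex d))
    (he : IsNNEdge e) : ∃ K, ∀ k ≥ K, (stage κ U k e ↔ everOpen κ U e) := by
  induction e using h.induction with
  | _ e ih =>
    have : ∀ f, ∃ K, earlier U f e → ∀ k ≥ K, (stage κ U k f ↔ everOpen κ U f) := fun f => by
      by_cases hf : earlier U f e
      · obtain ⟨K, hK⟩ := ih f hf hf.1.1
        exact ⟨K, fun _ => hK⟩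
      · exact ⟨0, fun h' => absurd h' hf⟩
    choose K hK using this
    obtain ⟨M, hM⟩ := ((finite_earlier U e).image K).bddAbove
    have hst : ∀ k ≥ M, (stage κ U (k + 1) e ↔ stage κ U (M + 1) e) := by
      intro k hk
      simp only [stage]
      refine forall₂_congr fun v hv => ?_
      rw [setOf_smaller_congr he hv (σ' := stage κ U M)]
      intro f hf
      have hKM : K f ≤ M := hM ⟨f, hf, rfl⟩
      exact (hK f hf k (hKM.trans hk)).trans (hK f hf M hKM).symm
    refine ⟨M + 1, fun k hk => ⟨fun hs => ⟨M + 1, fun j hj => ?_⟩, fun ⟨J, hJ⟩ => ?_⟩⟩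
    · obtain ⟨k, rfl⟩ := Nat.exists_eq_add_of_le' (show 1 ≤ k by omega)
      obtain ⟨j, rfl⟩ := Nat.exists_eq_add_of_le' (show 1 ≤ j by omega)
      exact (hst j (by omega)).2 ((hst k (by omega)).1 hs)
    · obtain ⟨k, rfl⟩ := Nat.exists_eq_add_of_le' (show 1 ≤ k by omega)
      exact (hst k (by omega)).2 ((hst (max J M) (le_max_right _ _)).1
        (hJ _ ((le_max_left _ _).trans (Nat.le_succ _))))

theorem consistent_everOpen {U : Config d} (h : WellFounded (earlier U)) :
    Consistent κ U (everOpen κ U) := by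
  intro e he
  have : ∀ f, ∃ K, earlier U f e → ∀ k ≥ K, (stage κ U k f ↔ everOpen κ U f) := fun f => by
    by_cases hf : earlier U f e
    · obtain ⟨K, hK⟩ := stage_eventually_const (κ := κ) h f hf.1.1
      exact ⟨K, fun _ => hK⟩
    · exact ⟨0, fun h' => absurd h' hf⟩
  choose K hK using this
  obtain ⟨M, hM⟩ := ((finite_earlier U e).image K).bddAbove
  obtain ⟨N, hN⟩ := stage_eventually_const (κ := κ) h e he
  rw [← hN (max N M + 1) (by omega)]
  simp only [stage]
  refine forall₂_congr fun v hv => ?_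
  rw [setOf_smaller_congr he hv (σ' := everOpen κ U)]
  intro f hf
  have hKM : K f ≤ M := hM ⟨f, hf, rfl⟩
  exact hK f hf _ (hKM.trans (le_max_right _ _))

theorem Consistent.iff_everOpen {U : Config d} (h : WellFounded (earlier U))
    {σ : Sym2 (Vertex d) → Prop} (hσ : Consistent κ U σ) (e : Sym2 (Vertex d)) (he : IsNNEdge e) :
    σ e ↔ everOpen κ U e := by
  induction e using h.induction with
  | _ e ih =>
    rw [hσ e he, consistent_everOpen h e he]
    refine forall₂_congr fun v hv => ?_
    rw [setOf_smaller_congr he hv fun f hf => ih f hf hf.1.1]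

theorem openEdge_iff {U : Config d} (h : WellFounded (earlier U)) {q : ℝ} {e : Sym2 (Vertex d)} :
    openEdge κ U q e ↔ IsNNEdge e ∧ U e ≤ q ∧ everOpen κ U e :=
  ⟨fun ⟨he, hq, _, hσ, hσe⟩ => ⟨he, hq, (hσ.iff_everOpen h e he).1 hσe⟩,
    fun ⟨he, hq, ho⟩ => ⟨he, hq, _, consistent_everOpen h, ho⟩⟩

/-- The combinatorial shape of `modifiedOneArm`, in terms of the set `O` of open edges, the set `L`
of edges that have arrived, and the order `lt` of arrival. -/
def Arm (n : ℕ) (O L : Sym2 (Vertex d) → Prop) (lt : Sym2 (Vertex d) → Sym2 (Vertex d) → Prop) :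
    Prop :=
  ∃ (k : ℕ) (x : ℕ → Vertex d),
    IsPathOn k x ∧ norm1 (x 0) = (n : ℤ) ∧ (∀ i, 1 ≤ i → i ≤ k → norm1 (x i) < (n : ℤ)) ∧
    x k = 0 ∧
    ∃ l ≤ k,
      (∀ i < l, O s(x i, x (i + 1))) ∧
      (∀ i, l ≤ i → i < k → L s(x i, x (i + 1))) ∧
      (∀ i, l ≤ i → i + 1 < k → lt s(x (i + 1), x (i + 2)) s(x i, x (i + 1)))

theorem modifiedOneArm_iff_arm {q : ℝ} {U : Config d} :
    modifiedOneArm κ n q U ↔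
      Arm n (openEdge κ U q) (fun e => U e ≤ q) (fun f e => U f < U e) := Iff.rfl

/-- The lattice edges of a box containing all paths relevant to the one-arm event. -/
noncomputable def boxEdges (d n : ℕ) : Finset (Sym2 (Vertex d)) := by
  classical exact
    (Finset.Icc (fun _ => -(n : ℤ) : Vertex d) (fun _ => (n : ℤ))).sym2.filter IsNNEdge

theorem isNNEdge_of_mem_boxEdges {e : Sym2 (Vertex d)} (he : e ∈ boxEdges d n) : IsNNEdge e := by
  classical
  unfold boxEdges at he
  exact (Finset.mem_filter.1 he).2

theorem mem_box_of_norm1_le {x : Vertex d} (hx : norm1 x ≤ n) :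
    x ∈ Finset.Icc (fun _ => -(n : ℤ) : Vertex d) (fun _ => (n : ℤ)) := by
  have hi : ∀ i, |x i| ≤ n := fun i => le_trans
    (Finset.single_le_sum (f := fun i => |x i|) (fun _ _ => abs_nonneg _) (Finset.mem_univ i)) hx
  rw [Finset.mem_Icc]
  exact ⟨fun i => (abs_le.1 (hi i)).1, fun i => (abs_le.1 (hi i)).2⟩

theorem Arm.mono {O L O' L' : Sym2 (Vertex d) → Prop}
    {lt lt' : Sym2 (Vertex d) → Sym2 (Vertex d) → Prop} (h : Arm n O L lt)
    (hO : ∀ e ∈ boxEdges d n, O e → O' e) (hL : ∀ e ∈ boxEdges d n, L e → L' e)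
    (hlt : ∀ e ∈ boxEdges d n, ∀ f ∈ boxEdges d n, touch f e → L e → lt f e → lt' f e) :
    Arm n O' L' lt' := by
  obtain ⟨k, x, hx, h0, hn, hk, l, hl, h1, h2, h3⟩ := h
  have hbox : ∀ i < k, s(x i, x (i + 1)) ∈ boxEdges d n := by
    intro i hi
    have hle : ∀ j ≤ k, norm1 (x j) ≤ n := fun j hj => by
      rcases Nat.eq_zero_or_pos j with rfl | hj'
      · exact h0.le
      · exact (hn j hj' hj).le
    classical
    unfold boxEdges
    refine Finset.mem_filter.2 ⟨?_, _, _, hx.1 i hi, rfl⟩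
    rw [Finset.mk_mem_sym2_iff]
    exact ⟨mem_box_of_norm1_le (hle i hi.le), mem_box_of_norm1_le (hle (i + 1) hi)⟩
  exact ⟨k, x, hx, h0, hn, hk, l, hl, fun i hi => hO _ (hbox i (by omega)) (h1 i hi),
    fun i hi hik => hL _ (hbox i hik) (h2 i hi hik),
    fun i hi hik => hlt _ (hbox i (by omega)) _ (hbox (i + 1) hik)
      (touch_walk (hx.1 i (by omega)) (hx.1 (i + 1) hik)).symm (h2 i hi (by omega)) (h3 i hi hik)⟩

theorem modifiedOneArm_mono {U : Config d} {a b : ℝ} (hab : a ≤ b)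
    (h : modifiedOneArm κ n a U) : modifiedOneArm κ n b U := by
  rw [modifiedOneArm_iff_arm] at h ⊢
  exact h.mono (fun e _ ⟨h1, h2, h3⟩ => ⟨h1, h2.trans hab, h3⟩) (fun e _ h' => h'.trans hab)
    fun _ _ _ _ _ _ => id

/-- Two configurations whose labels have the same relative order, and the same position relative to
the respective thresholds, on a backward-closed set of edges containing the box, agree on the
one-arm event. -/
theorem modifiedOneArm_congr {U U' : Config d} {q q' : ℝ} {S : Set (Sym2 (Vertex d))}
    (hbox : ∀ e ∈ boxEdges d n, e ∈ S) (hS : ∀ e ∈ S, ∀ f, earlier U f e → f ∈ S)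
    (hU : WellFounded (earlier U)) (hU' : WellFounded (earlier U'))
    (hq : ∀ e ∈ S, (U e ≤ q ↔ U' e ≤ q'))
    (hlt : ∀ e ∈ S, U e ≤ q → ∀ f, touch f e → f ≠ e → (U f < U e ↔ U' f < U' e)) :
    modifiedOneArm κ n q U ↔ modifiedOneArm κ n q' U' := by
  have hopen : ∀ e, IsNNEdge e → e ∈ S → U e ≤ q → (everOpen κ U e ↔ everOpen κ U' e) := by
    intro e
    induction e using hU.induction with
    | _ e ih =>
      intro he heS heq
      rw [consistent_everOpen hU e he, consistent_everOpen hU' e he]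
      refine forall₂_congr fun v hv => ?_
      suffices hset : {f : Sym2 (Vertex d) | IsNNEdge f ∧ v ∈ f ∧ f ≠ e ∧ U f < U e ∧
          everOpen κ U f} = {f | IsNNEdge f ∧ v ∈ f ∧ f ≠ e ∧ U' f < U' e ∧ everOpen κ U' f} by
        rw [hset]
      ext f
      simp only [Set.mem_ofPred_eq]
      refine and_congr_right fun hf => and_congr_right fun hvf => and_congr_right fun hfe => ?_
      have ht : touch f e := ⟨hf, he, v, hvf, hv⟩
      rw [← hlt e heS heq f ht hfe]
      exact and_congr_right fun hfe' =>
        ih f ⟨ht, hfe'⟩ hf (hS e heS f ⟨ht, hfe'⟩) (hfe'.le.trans heq)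
  rw [modifiedOneArm_iff_arm, modifiedOneArm_iff_arm]
  constructor
  · intro h
    refine h.mono (fun e he hoe => ?_) (fun e he => (hq e (hbox e he)).1) ?_
    · rw [openEdge_iff hU] at hoe
      rw [openEdge_iff hU']
      exact ⟨hoe.1, (hq e (hbox e he)).1 hoe.2.1, (hopen e hoe.1 (hbox e he) hoe.2.1).1 hoe.2.2⟩
    · intro e he f hf ht heq hfe
      exact (hlt e (hbox e he) heq f ht (by rintro rfl; exact lt_irrefl _ hfe)).1 hfe
  · intro h
    refine h.mono (fun e he hoe => ?_) (fun e he => (hq e (hbox e he)).2) ?_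
    · rw [openEdge_iff hU'] at hoe
      rw [openEdge_iff hU]
      have heq := (hq e (hbox e he)).2 hoe.2.1
      exact ⟨hoe.1, heq, (hopen e hoe.1 (hbox e he) heq).2 hoe.2.2⟩
    · intro e he f hf ht heq hfe
      exact (hlt e (hbox e he) ((hq e (hbox e he)).2 heq) f ht
        (by rintro rfl; exact lt_irrefl _ hfe)).2 hfe

/-- The edges reached from the box by chains of touching edges with decreasing labels. -/
inductive Reach (n : ℕ) (U : Config d) : Sym2 (Vertex d) → Prop
  | base {e : Sym2 (Vertex d)} : e ∈ boxEdges d n → Reach n U e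
  | step {e f : Sym2 (Vertex d)} : Reach n U e → earlier U f e → Reach n U f

/-- The edges of the box together with those touching an edge in `Reach n U`. -/
def Relevant (n : ℕ) (U : Config d) (e : Sym2 (Vertex d)) : Prop :=
  e ∈ boxEdges d n ∨ ∃ g, Reach n U g ∧ touch e g

theorem Reach.relevant {U : Config d} {e : Sym2 (Vertex d)} (h : Reach n U e) :
    Relevant n U e := by
  cases h with
  | base h => exact Or.inl h
  | step h h' => exact Or.inr ⟨_, h, h'.1⟩

theorem modifiedOneArm_iff_of_forall_notMem {U : Config d} (hU : WellFounded (earlier U)) {a b : ℝ}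
    (hab : a ≤ b) (h : ∀ e, Relevant n U e → U e ∉ Set.Ioc a b) :
    modifiedOneArm κ n a U ↔ modifiedOneArm κ n b U := by
  refine modifiedOneArm_congr (S := {e | Reach n U e}) (fun e => Reach.base)
    (fun e he f => Reach.step he) hU hU (fun e he => ?_) (fun _ _ _ _ _ _ => Iff.rfl)
  have := h e (Reach.relevant he)
  rw [Set.mem_Ioc, not_and] at this
  exact ⟨fun h' => h'.trans hab, fun h' => not_lt.1 fun h'' => this h'' h'⟩

section OneRelevant

variable {U : Config d} {a b p : ℝ} {e₀ : Sym2 (Vertex d)}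

theorem le_iff_of_forall_relevant (hap : a ≤ p) (hpb : p ≤ b)
    (h : ∀ e, Relevant n U e → U e ∈ Set.Ioc a b → e = e₀) {e : Sym2 (Vertex d)}
    (he : Relevant n U e) (hne : e ≠ e₀) : (U e ≤ a ↔ U e ≤ p) ∧ (U e ≤ b ↔ U e ≤ p) := by
  have h1 : U e ≤ b → U e ≤ a := fun hb => not_lt.1 fun ha => hne (h e he ⟨ha, hb⟩)
  exact ⟨⟨fun h' => h'.trans hap, fun h' => h1 (h'.trans hpb)⟩,
    fun h' => (h1 h').trans hap, fun h' => h'.trans hpb⟩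

theorem modifiedOneArm_iff_update_one (hU : Regular U) (hap : a ≤ p) (hpb : p ≤ b)
    (hp : p < 1) (he₀ : U e₀ ∈ Set.Ioc a b)
    (h : ∀ e, Relevant n U e → U e ∈ Set.Ioc a b → e = e₀) :
    modifiedOneArm κ n a U ↔ modifiedOneArm κ n p (Function.update U e₀ 1) := by
  refine modifiedOneArm_congr (S := {e | Reach n U e}) (fun e => Reach.base)
    (fun e he f => Reach.step he) hU.wf (wellFounded_earlier_update hU.wf _ _) (fun e he => ?_) ?_
  · by_cases hne : e = e₀
    · subst hne
      rw [Function.update_self]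
      exact iff_of_false (not_le.2 he₀.1) (not_le.2 hp)
    · rw [Function.update_of_ne hne]
      exact (le_iff_of_forall_relevant hap hpb h (Reach.relevant he) hne).1
  · intro e he hea f hf hfe
    have hne : e ≠ e₀ := by
      rintro rfl
      exact absurd he₀.1 (not_lt.2 hea)
    rw [Function.update_of_ne hne]
    by_cases hfe₀ : f = e₀
    · subst hfe₀
      rw [Function.update_self]
      exact iff_of_false (not_lt.2 (hea.trans he₀.1.le))
        (not_lt.2 (hU.mem_Icc e hf.2.1).2)
    · rw [Function.update_of_ne hfe₀]

theorem modifiedOneArm_iff_update_self (hU : Regular U) (hap : a ≤ p) (hpb : p ≤ b)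
    (hgen : ∀ f, IsNNEdge f → U f ≠ p) (he₀ : U e₀ ∈ Set.Ioc a b)
    (h : ∀ e, Relevant n U e → U e ∈ Set.Ioc a b → e = e₀) :
    modifiedOneArm κ n b U ↔ modifiedOneArm κ n p (Function.update U e₀ p) := by
  refine modifiedOneArm_congr (S := {e | Reach n U e}) (fun e => Reach.base)
    (fun e he f => Reach.step he) hU.wf (wellFounded_earlier_update hU.wf _ _) (fun e he => ?_) ?_
  · by_cases hne : e = e₀
    · subst hne
      simp [he₀.2]
    · rw [Function.update_of_ne hne]
      exact (le_iff_of_forall_relevant hap hpb h (Reach.relevant he) hne).2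
  · intro e he heb f hf hfe
    by_cases hne : e = e₀
    · subst hne
      rw [Function.update_self, Function.update_of_ne hfe]
      obtain ⟨h1, h2⟩ := le_iff_of_forall_relevant hap hpb h (Or.inr ⟨e, he, hf⟩) hfe
      constructor
      · intro hlt
        exact lt_of_le_of_ne (h2.1 (hlt.le.trans heb)) (hgen f hf.1)
      · intro hlt
        exact (h1.2 hlt.le).trans_lt he₀.1
    · have hea : U e ≤ a := by
        obtain ⟨h1, h2⟩ := le_iff_of_forall_relevant hap hpb h (Reach.relevant he) hne
        exact h1.2 (h2.1 heb)
      rw [Function.update_of_ne hne]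
      by_cases hfe₀ : f = e₀
      · subst hfe₀
        rw [Function.update_self]
        exact iff_of_false (not_lt.2 (hea.trans he₀.1.le)) (not_lt.2 (hea.trans hap))
      · rw [Function.update_of_ne hfe₀]

theorem modifiedOneArm_update_iff_of_not_relevant (hU : Regular U) (q q' : ℝ)
    (h : ¬ Relevant n U e₀) :
    modifiedOneArm κ n p (Function.update U e₀ q) ↔
      modifiedOneArm κ n p (Function.update U e₀ q') := by
  have hne : ∀ e, Reach n U e → e ≠ e₀ := by
    rintro e he rfl
    exact h he.relevant
  have hne' : ∀ e f, Reach n U e → touch f e → f ≠ e₀ := by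
    rintro e f he hf rfl
    exact h (Or.inr ⟨e, he, hf⟩)
  refine modifiedOneArm_congr (S := {e | Reach n U e}) (fun e => Reach.base)
    (fun e he f hf => Reach.step he ⟨hf.1, ?_⟩) (wellFounded_earlier_update hU.wf _ _)
    (wellFounded_earlier_update hU.wf _ _) (fun e he => ?_) fun e he _ f hf _ => ?_
  · have := hf.2
    rwa [Function.update_of_ne (hne e he), Function.update_of_ne (hne' e f he hf.1)] at this
  · rw [Function.update_of_ne (hne e he), Function.update_of_ne (hne e he)]
  · rw [Function.update_of_ne (hne e he), Function.update_of_ne (hne e he),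
      Function.update_of_ne (hne' e f he hf), Function.update_of_ne (hne' e f he hf)]

theorem modifiedOneArm_iff_update_one_of_lt (hU : Regular U) (hp : p < 1) (h : p < U e₀) :
    modifiedOneArm κ n p U ↔ modifiedOneArm κ n p (Function.update U e₀ 1) := by
  refine modifiedOneArm_congr (S := Set.univ) (fun _ _ => trivial) (fun _ _ _ _ => trivial) hU.wf
    (wellFounded_earlier_update hU.wf _ _) (fun e _ => ?_) fun e _ hep f hf hfe => ?_
  · by_cases hne : e = e₀
    · subst hne
      rw [Function.update_self]
      exact iff_of_false (not_le.2 h) (not_le.2 hp)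
    · rw [Function.update_of_ne hne]
  · have hne : e ≠ e₀ := by
      rintro rfl
      exact absurd h (not_lt.2 hep)
    rw [Function.update_of_ne hne]
    by_cases hfe₀ : f = e₀
    · subst hfe₀
      rw [Function.update_self]
      exact iff_of_false (not_lt.2 (hep.trans h.le)) (not_lt.2 (hep.trans hp.le))
    · rw [Function.update_of_ne hfe₀]

end OneRelevant

/-- The lists of `m + 1` edges, consecutive ones touching, whose last entry lies in `B`. -/
noncomputable def chains (B : Finset (Sym2 (Vertex d))) : ℕ → Finset (List (Sym2 (Vertex d)))
  | 0 => by classical exact B.image fun e => [e]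
  | m + 1 => by
      classical exact (chains B m).biUnion fun l =>
        (l.head?.toFinset.biUnion fun e => e.toFinset.biUnion edgesAt).image fun f => f :: l

theorem singleton_mem_chains {B : Finset (Sym2 (Vertex d))} {e : Sym2 (Vertex d)} (he : e ∈ B) :
    [e] ∈ chains B 0 := by
  classical exact Finset.mem_image_of_mem _ he

theorem cons_mem_chains {B : Finset (Sym2 (Vertex d))} {m : ℕ} {l : List (Sym2 (Vertex d))}
    {e f : Sym2 (Vertex d)} (hl : e :: l ∈ chains B m) (hf : touch f e) :
    f :: e :: l ∈ chains B (m + 1) := by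
  classical
  obtain ⟨hf', -, v, hv, hve⟩ := hf
  refine Finset.mem_biUnion.2 ⟨e :: l, hl, Finset.mem_image.2 ⟨f, ?_, rfl⟩⟩
  exact Finset.mem_biUnion.2 ⟨e, by simp, Finset.mem_biUnion.2
    ⟨v, Sym2.mem_toFinset.2 hve, mem_edgesAt hf' hv⟩⟩

theorem length_of_mem_chains {B : Finset (Sym2 (Vertex d))} {m : ℕ} {l : List (Sym2 (Vertex d))}
    (hl : l ∈ chains B m) : l.length = m + 1 := by
  classical
  induction m generalizing l with
  | zero =>
    obtain ⟨e, -, rfl⟩ := Finset.mem_image.1 hl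
    rfl
  | succ m ih =>
    obtain ⟨l', hl', hl⟩ := Finset.mem_biUnion.1 hl
    obtain ⟨f, -, rfl⟩ := Finset.mem_image.1 hl
    simp [ih hl']

theorem card_chains_le (B : Finset (Sym2 (Vertex d))) (m : ℕ) :
    (chains B m).card ≤ B.card * (2 * (Finset.Icc (-1 : Vertex d) 1).card) ^ m := by
  classical
  induction m with
  | zero => simpa using! (Finset.card_image_le (s := B) (f := fun e => [e]))
  | succ m ih =>
    rw [pow_succ, ← mul_assoc]
    refine (Finset.card_biUnion_le_card_mul _ _ (2 * (Finset.Icc (-1 : Vertex d) 1).card)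
      fun l _ => ?_).trans (Nat.mul_le_mul_right _ ih)
    refine Finset.card_image_le.trans ?_
    cases l with
    | nil => simp
    | cons e l =>
      simp only [List.head?_cons, Option.toFinset_some, Finset.singleton_biUnion]
      refine (Finset.card_biUnion_le_card_mul _ _ _ fun v _ => Finset.card_image_le).trans
        (Nat.mul_le_mul_right _ ?_)
      rw [Sym2.card_toFinset]
      split <;> omega

theorem Reach.exists_chain {U : Config d} {e : Sym2 (Vertex d)} (h : Reach n U e) :
    ∃ m l, e :: l ∈ chains (boxEdges d n) m ∧ (e :: l).Pairwise (fun f g => U f < U g) := by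
  induction h with
  | base he => exact ⟨0, [], singleton_mem_chains he, by simp⟩
  | @step e f _ hf ih =>
    obtain ⟨m, l, hl, hs⟩ := ih
    refine ⟨m + 1, e :: l, cons_mem_chains hl hf.1, List.pairwise_cons.2 ⟨?_, hs⟩⟩
    intro g hg
    rcases List.mem_cons.1 hg with rfl | hg
    · exact hf.2
    · exact hf.2.trans ((List.pairwise_cons.1 hs).1 g hg)

theorem exists_suffix_mem_chains {B : Finset (Sym2 (Vertex d))} {m : ℕ}
    {l : List (Sym2 (Vertex d))} (hl : l ∈ chains B m) {e : Sym2 (Vertex d)} (he : e ∈ l) :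
    ∃ m' l', e :: l' ∈ chains B m' ∧ e :: l' <:+ l := by
  classical
  induction m generalizing l with
  | zero =>
    obtain ⟨f, hf, rfl⟩ := Finset.mem_image.1 hl
    rw [List.mem_singleton] at he
    subst he
    exact ⟨0, [], hl, List.suffix_refl _⟩
  | succ m ih =>
    obtain ⟨l', hl', hl''⟩ := Finset.mem_biUnion.1 hl
    obtain ⟨f, -, rfl⟩ := Finset.mem_image.1 hl''
    rcases List.mem_cons.1 he with rfl | he
    · exact ⟨m + 1, l', hl, List.suffix_refl _⟩
    · obtain ⟨m', l'', h1, h2⟩ := ih hl' he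
      exact ⟨m', l'', h1, h2.trans (List.suffix_cons _ _)⟩

theorem Relevant.exists_chain {U : Config d} {e : Sym2 (Vertex d)} (h : Relevant n U e) :
    ∃ m l, e :: l ∈ chains (boxEdges d n) m ∧ e ∉ l ∧ l.Pairwise (fun f g => U f < U g) := by
  rcases h with he | ⟨g, hg, hge⟩
  · exact ⟨0, [], singleton_mem_chains he, by simp, by simp⟩
  · obtain ⟨m, l, hl, hs⟩ := hg.exists_chain
    by_cases he : e ∈ g :: l
    · obtain ⟨m', l', h1, h2⟩ := exists_suffix_mem_chains hl he
      have h3 := List.pairwise_cons.1 (hs.sublist h2.sublist)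
      exact ⟨m', l', h1, fun h4 => lt_irrefl _ (h3.1 e h4), h3.2⟩
    · exact ⟨m + 1, g :: l, cons_mem_chains hl hge, he, hs⟩

/-- The uniform distribution on `[0,1]`. -/
noncomputable def unif : Measure ℝ := (volume : Measure ℝ).restrict (Set.Icc 0 1)

instance : IsProbabilityMeasure unif := ⟨by simp [unif]⟩

instance : NullSingletonClass unif := by unfold unif; infer_instance

/-- The law of a family of i.i.d. uniform labels. -/
noncomputable def labelLaw (α : Type*) : Measure (α → ℝ) := Measure.infinitePi fun _ => unif

instance (α : Type*) : IsProbabilityMeasure (labelLaw α) := by unfold labelLaw; infer_instance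

theorem IsProductUniform.eq_labelLaw {P : Measure (Config d)} (hP : IsProductUniform P) :
    P = labelLaw (Sym2 (Vertex d)) := by
  refine Measure.eq_infinitePi _ fun s t ht => ?_
  have : (Set.pi s t : Set (Config d)) = {U | ∀ e ∈ s, U e ∈ t e} := by
    ext U
    simp [Set.mem_pi]
  rw [this, hP.2 s t fun e _ => ht e]
  exact Finset.prod_congr rfl fun e _ => by rw [unif, Measure.restrict_apply (ht e)]

section LabelLaw

variable {α : Type*}

theorem measurePreserving_comp_perm (π : Equiv.Perm α) :
    MeasurePreserving (fun U : α → ℝ => fun x => U (π x)) (labelLaw α) (labelLaw α) := by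
  classical
  refine ⟨by fun_prop, Measure.eq_infinitePi _ fun s t ht => ?_⟩
  rw [Measure.map_apply (by fun_prop) (.pi s.countable_toSet fun i _ => ht i)]
  have : (fun U : α → ℝ => fun x => U (π x)) ⁻¹' (s : Set α).pi t =
      ((s.map π.toEmbedding : Finset α) : Set α).pi fun x => t (π.symm x) := by
    ext U
    simp only [Set.mem_preimage, Set.mem_pi, Finset.coe_map, Set.mem_image, Finset.mem_coe,
      Equiv.coe_toEmbedding]
    constructor
    · rintro h _ ⟨i, hi, rfl⟩
      simpa using h i hi
    · intro h i hi
      simpa using h (π i) ⟨i, hi, rfl⟩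
  rw [this, labelLaw, Measure.infinitePi_pi _ fun i _ => ht _, Finset.prod_map]
  simp

theorem measurable_update_pair [DecidableEq α] (e : α) :
    Measurable fun z : ℝ × (α → ℝ) => Function.update z.2 e z.1 := by
  refine measurable_pi_iff.2 fun x => ?_
  by_cases hx : x = e
  · subst hx
    simpa using measurable_fst
  · simpa [Function.update_of_ne hx, Function.comp_def] using
      (measurable_pi_apply x).comp measurable_snd

theorem measurePreserving_update [DecidableEq α] (e : α) :
    MeasurePreserving (fun z : ℝ × (α → ℝ) => Function.update z.2 e z.1)
      (unif.prod (labelLaw α)) (labelLaw α) := by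
  refine ⟨measurable_update_pair e, Measure.eq_infinitePi _ fun s t ht => ?_⟩
  rw [Measure.map_apply (measurable_update_pair e) (.pi s.countable_toSet fun i _ => ht i)]
  have herase : (fun z : ℝ × (α → ℝ) => Function.update z.2 e z.1) ⁻¹' (s : Set α).pi t =
      (if e ∈ s then t e else Set.univ) ×ˢ ((s.erase e : Finset α) : Set α).pi t := by
    ext ⟨u, U⟩
    simp only [Set.mem_preimage, Set.mem_pi, Set.mem_prod, Finset.mem_coe, Finset.mem_erase]
    constructor
    · intro h
      refine ⟨?_, fun x ⟨hx, hxs⟩ => by simpa [hx] using h x hxs⟩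
      split_ifs with hes
      · simpa using h e hes
      · trivial
    · rintro ⟨h1, h2⟩ x hx
      by_cases hxe : x = e
      · subst hxe
        simpa [hx] using h1
      · simpa [hxe] using h2 x ⟨hxe, hx⟩
  rw [herase, Measure.prod_prod, labelLaw, Measure.infinitePi_pi _ fun i _ => ht i]
  split_ifs with hes
  · exact Finset.mul_prod_erase s (fun i => unif (t i)) hes
  · rw [measure_univ, one_mul, Finset.erase_eq_of_notMem hes]

theorem labelLaw_eval_mem {J : Set ℝ} (hJ : MeasurableSet J) (e : α) :
    labelLaw α {U | U e ∈ J} = unif J := by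
  have := (measurePreserving_eval_infinitePi (fun _ : α => unif) e).measure_preimage
    hJ.nullMeasurableSet
  exact this

theorem labelLaw_inter_of_update_iff [DecidableEq α] {e : α} {J : Set ℝ} (hJ : MeasurableSet J)
    {B : Set (α → ℝ)} (hB : MeasurableSet B) (h : ∀ U u, Function.update U e u ∈ B ↔ U ∈ B) :
    labelLaw α ({U | U e ∈ J} ∩ B) = unif J * labelLaw α B := by
  have hm : MeasurableSet ({U : α → ℝ | U e ∈ J} ∩ B) := (measurable_pi_apply e hJ).inter hB
  rw [← (measurePreserving_update e).measure_preimage hm.nullMeasurableSet, ← Measure.prod_prod]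
  congr 1
  ext ⟨u, U⟩
  simp [h]

theorem labelLaw_pair {e f : α} (hef : e ≠ f) {J : Set ℝ} (hJ : MeasurableSet J) :
    labelLaw α {U | U e ∈ J ∧ U f ∈ J} = unif J * unif J := by
  classical
  have := labelLaw_inter_of_update_iff (e := e) hJ (measurable_pi_apply f hJ)
    (fun U u => by simp [Function.update_of_ne hef.symm])
  exact this.trans (by rw [show labelLaw α ((fun U => U f) ⁻¹' J) = unif J from
    labelLaw_eval_mem hJ f])

theorem labelLaw_eq_null {e f : α} (hef : e ≠ f) : labelLaw α {U | U e = U f} = 0 := by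
  classical
  have hm : MeasurableSet {U : α → ℝ | U e = U f} :=
    measurableSet_eq_fun (measurable_pi_apply e) (measurable_pi_apply f)
  have hm' := measurable_update_pair e hm
  rw [← (measurePreserving_update e).measure_preimage hm.nullMeasurableSet,
    Measure.prod_apply_symm hm']
  refine (lintegral_congr fun U => ?_).trans lintegral_zero
  have : (fun u => (u, U)) ⁻¹' ((fun z : ℝ × (α → ℝ) => Function.update z.2 e z.1) ⁻¹'
      {U | U e = U f}) = {U f} := by
    ext u
    simp [Function.update_of_ne hef.symm]
  rw [this, measure_singleton]

open Nat in
theorem labelLaw_inter_sorted_le {C : Set (α → ℝ)} (hC : MeasurableSet C) (l : List α)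
    (hCl : ∀ (π : Equiv.Perm α), (∀ x ∉ l, π x = x) → ∀ U, (fun x => U (π x)) ∈ C ↔ U ∈ C) :
    labelLaw α (C ∩ {U | l.Pairwise fun x y => U x < U y}) ≤
      labelLaw α C * (l.length ! : ENNReal)⁻¹ := by
  classical
  by_cases hl : l.Nodup
  swap
  · have : {U : α → ℝ | l.Pairwise fun x y => U x < U y} = ∅ := by
      refine Set.eq_empty_iff_forall_notMem.2 fun U hU => hl ?_
      exact List.Pairwise.imp (fun h => by rintro rfl; exact lt_irrefl _ h) hU
    rw [this]
    simp
  let g : Fin l.length ↪ α := ⟨l.get, List.nodup_iff_injective_get.1 hl⟩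
  let A : Equiv.Perm (Fin l.length) → Set (α → ℝ) := fun σ =>
    C ∩ {U | StrictMono fun i => U (g (σ i))}
  have hA1 : C ∩ {U | l.Pairwise fun x y => U x < U y} = A 1 := by
    ext U
    simp only [A, Set.mem_inter_iff, Set.mem_ofPred_eq, List.pairwise_iff_get]
    exact Iff.rfl
  have hAm : ∀ σ, MeasurableSet (A σ) := by
    intro σ
    refine hC.inter ?_
    have : {U : α → ℝ | StrictMono fun i => U (g (σ i))} =
        ⋂ i, ⋂ j, ⋂ (_ : i < j), {U | U (g (σ i)) < U (g (σ j))} := by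
      ext U
      simp [StrictMono]
    rw [this]
    exact .iInter fun i => .iInter fun j => .iInter fun _ =>
      measurableSet_lt (measurable_pi_apply _) (measurable_pi_apply _)
  have hAeq : ∀ σ, labelLaw α (A σ) = labelLaw α (A 1) := by
    intro σ
    rw [← (measurePreserving_comp_perm (σ.viaFintypeEmbedding g)).measure_preimage
      (hAm 1).nullMeasurableSet]
    congr 1
    ext U
    simp only [A, Set.mem_inter_iff, Set.mem_preimage, Set.mem_ofPred_eq, Equiv.Perm.coe_one, id,
      Equiv.Perm.viaFintypeEmbedding_apply_image]
    rw [hCl]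
    intro x hx
    refine Equiv.Perm.viaFintypeEmbedding_apply_notMem_range σ g ?_
    rintro ⟨i, rfl⟩
    exact hx (List.get_mem l i)
  have hdisj : Pairwise (Function.onFun Disjoint A) := by
    intro σ τ hστ
    refine Set.disjoint_left.2 fun U hσ hτ => hστ ?_
    have h1 : StrictMono ((fun i => U (g i)) ∘ σ) := hσ.2
    have h2 : StrictMono ((fun i => U (g i)) ∘ τ) := hτ.2
    have h3 := Tuple.unique_monotone h1.monotone h2.monotone
    have hinj : Function.Injective fun i => U (g i) := by
      have := h1.injective.comp σ.symm.injective
      simpa [Function.comp_def] using this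
    ext i
    exact congrArg _ (hinj (congrFun h3 i))
  have hsum : (l.length ! : ENNReal) * labelLaw α (A 1) ≤ labelLaw α C := by
    have h1 : ∑ σ, labelLaw α (A σ) = (l.length ! : ENNReal) * labelLaw α (A 1) := by
      rw [Finset.sum_congr rfl fun σ _ => hAeq σ]
      simp [Fintype.card_perm]
    rw [← h1, ← tsum_fintype (L := .unconditional _), ← measure_iUnion hdisj hAm]
    exact measure_mono (Set.iUnion_subset fun σ => Set.inter_subset_left)
  rw [hA1, ← div_eq_mul_inv, ENNReal.le_div_iff_mul_le (by simp [Nat.factorial_ne_zero]) (by simp),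
    mul_comm]
  exact hsum

open Nat in
theorem labelLaw_sorted_le (l : List α) :
    labelLaw α {U | l.Pairwise fun x y => U x < U y} ≤ (l.length ! : ENNReal)⁻¹ := by
  have := labelLaw_inter_sorted_le MeasurableSet.univ l fun _ _ _ => by simp
  simpa using this

end LabelLaw

open Nat in
theorem tsum_card_chains_ne_top (B : Finset (Sym2 (Vertex d))) :
    ∑' m, ((chains B m).card : ENNReal) * (m ! : ENNReal)⁻¹ ≠ ⊤ := by
  set K := 2 * (Finset.Icc (-1 : Vertex d) 1).card
  have hs : Summable fun m : ℕ => (B.card : ℝ) * ((K : ℝ) ^ m / (m ! : ℝ)) :=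
    (Real.summable_pow_div_factorial (K : ℝ)).mul_left _
  refine ne_top_of_le_ne_top hs.tsum_ofReal_ne_top (ENNReal.tsum_le_tsum fun m => ?_)
  have : ((chains B m).card : ENNReal) ≤ ((B.card * K ^ m : ℕ) : ENNReal) := by
    exact_mod_cast card_chains_le B m
  refine (mul_le_mul_left this _).trans (le_of_eq ?_)
  rw [← mul_div_assoc, ENNReal.ofReal_div_of_pos (by positivity), ENNReal.ofReal_natCast,
    div_eq_mul_inv]
  congr 1
  rw [← Nat.cast_pow, ← Nat.cast_mul, ENNReal.ofReal_natCast]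

theorem exists_sorted_chain {V : Config d} {w : ℕ → Sym2 (Vertex d)}
    (hw : ∀ i, earlier V (w (i + 1)) (w i)) (m : ℕ) :
    ∃ l ∈ chains {w 0} m, l.Pairwise fun f g => V f < V g := by
  suffices h : ∃ l, w m :: l ∈ chains {w 0} m ∧ (w m :: l).Pairwise fun f g => V f < V g by
    obtain ⟨l, hl⟩ := h
    exact ⟨_, hl⟩
  induction m with
  | zero => exact ⟨[], singleton_mem_chains (by simp), by simp⟩
  | succ m ih =>
    obtain ⟨l, hl, hs⟩ := ih
    refine ⟨w m :: l, cons_mem_chains hl (hw m).1, List.pairwise_cons.2 ⟨fun g hg => ?_, hs⟩⟩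
    rcases List.mem_cons.1 hg with rfl | hg
    · exact (hw m).2
    · exact (hw m).2.trans ((List.pairwise_cons.1 hs).1 g hg)

open Nat in
theorem ae_wellFounded_earlier {F : Config d → Config d}
    (hF : ∀ l : List (Sym2 (Vertex d)), labelLaw _ {U | l.Pairwise fun f g => F U f < F U g} ≤
      (l.length ! : ENNReal)⁻¹) :
    ∀ᵐ U ∂labelLaw (Sym2 (Vertex d)), WellFounded (earlier (F U)) := by
  have hnull : ∀ g : Sym2 (Vertex d), ∀ᵐ U ∂labelLaw (Sym2 (Vertex d)),
      ¬ ∀ m, ∃ l ∈ chains {g} m, l.Pairwise fun e f => F U e < F U f := by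
    intro g
    rw [ae_iff]
    simp only [not_not]
    refine le_antisymm ?_ zero_le
    refine ge_of_tendsto (ENNReal.tendsto_atTop_zero_of_tsum_ne_top
      (tsum_card_chains_ne_top {g})) (Filter.Eventually.of_forall fun m => ?_)
    calc labelLaw _ {U | ∀ m, ∃ l ∈ chains {g} m, l.Pairwise fun e f => F U e < F U f}
        ≤ labelLaw _ (⋃ l ∈ chains {g} m, {U | l.Pairwise fun e f => F U e < F U f}) := by
          refine measure_mono fun U hU => ?_
          obtain ⟨l, hl, hs⟩ := hU m
          exact Set.mem_biUnion hl hs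
      _ ≤ ∑ l ∈ chains {g} m, labelLaw _ {U | l.Pairwise fun e f => F U e < F U f} :=
          measure_biUnion_finset_le _ _
      _ ≤ ∑ l ∈ chains {g} m, (m ! : ENNReal)⁻¹ := by
          refine Finset.sum_le_sum fun l hl => (hF l).trans ?_
          rw [length_of_mem_chains hl, ENNReal.inv_le_inv]
          exact_mod_cast Nat.factorial_le (Nat.le_succ m)
      _ = _ := by rw [Finset.sum_const, nsmul_eq_mul]
  filter_upwards [ae_all_iff.2 hnull] with U hU
  rw [wellFounded_iff_isEmpty_descending_chain]
  exact ⟨fun ⟨w, hw⟩ => hU (w 0) fun m => exists_sorted_chain hw m⟩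

theorem ae_ne (q : ℝ) : ∀ᵐ U ∂labelLaw (Sym2 (Vertex d)), ∀ e, U e ≠ q := by
  refine ae_all_iff.2 fun e => ?_
  rw [ae_iff]
  simp only [ne_eq, not_not]
  exact (labelLaw_eval_mem (measurableSet_singleton q) e).trans (measure_singleton q)

theorem ae_regular : ∀ᵐ U ∂labelLaw (Sym2 (Vertex d)), Regular U := by
  have hIcc : ∀ e, ∀ᵐ U ∂labelLaw (Sym2 (Vertex d)), U e ∈ Set.Icc (0 : ℝ) 1 := by
    intro e
    have := labelLaw_eval_mem (measurableSet_Icc (a := (0 : ℝ)) (b := 1)).compl e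
    rw [ae_iff]
    refine this.trans ?_
    rw [unif, Measure.restrict_apply measurableSet_Icc.compl]
    simp
  have hinj : ∀ e f, ∀ᵐ U ∂labelLaw (Sym2 (Vertex d)), U e = U f → e = f := by
    intro e f
    by_cases hef : e = f
    · exact .of_forall fun _ _ => hef
    · rw [ae_iff]
      simpa [hef] using labelLaw_eq_null hef
  filter_upwards [ae_all_iff.2 hIcc, ae_all_iff.2 fun e => ae_all_iff.2 (hinj e),
    ae_wellFounded_earlier (F := fun U => U) labelLaw_sorted_le,
    ae_wellFounded_earlier (F := fun U => -U) fun l => by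
      have := labelLaw_sorted_le l.reverse
      simpa [List.pairwise_reverse] using this] with U h1 h2 h3 h4
  exact ⟨fun e _ => h1 e, fun e f _ _ => h2 e f, h3, h4⟩

open Nat Classical in
/-- The expected number of sorted chains leading from the box to `e`. -/
noncomputable def weight (n : ℕ) (e : Sym2 (Vertex d)) : ENNReal :=
  ∑' m, ∑ l ∈ chains (boxEdges d n) m, if l.head? = some e then (m ! : ENNReal)⁻¹ else 0

theorem tsum_weight_ne_top (d n : ℕ) : ∑' e : Sym2 (Vertex d), weight n e ≠ ⊤ := by
  classical
  refine ne_top_of_le_ne_top (tsum_card_chains_ne_top (boxEdges d n)) ?_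
  unfold weight
  rw [ENNReal.tsum_comm]
  refine ENNReal.tsum_le_tsum fun m => ?_
  rw [Summable.tsum_finsetSum fun _ _ => ENNReal.summable, ← nsmul_eq_mul, ← Finset.sum_const]
  refine Finset.sum_le_sum fun l hl => ?_
  cases l with
  | nil => simp
  | cons f l =>
    rw [tsum_eq_single f]
    · simp
    · intro e he
      simp [he.symm]

theorem labelLaw_relevant_le {J : Set ℝ} (hJ : MeasurableSet J) (e : Sym2 (Vertex d)) :
    labelLaw _ {U | U e ∈ J ∧ Relevant n U e} ≤ unif J * weight n e := by
  classical
  let X : List (Sym2 (Vertex d)) → Set (Config d) := fun l' =>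
    {U | ∃ l, l' = e :: l ∧ e ∉ l ∧ U e ∈ J ∧ l.Pairwise fun f g => U f < U g}
  have hsub : {U : Config d | U e ∈ J ∧ Relevant n U e} ⊆
      ⋃ m, ⋃ l ∈ chains (boxEdges d n) m, X l := by
    rintro U ⟨hUJ, hU⟩
    obtain ⟨m, l, hl, hel, hs⟩ := hU.exists_chain
    exact Set.mem_iUnion.2 ⟨m, Set.mem_biUnion hl ⟨l, rfl, hel, hUJ, hs⟩⟩
  refine (measure_mono hsub).trans ((measure_iUnion_le _).trans ?_)
  rw [weight, ← ENNReal.tsum_mul_left]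
  refine ENNReal.tsum_le_tsum fun m => (measure_biUnion_finset_le _ _).trans ?_
  rw [Finset.mul_sum]
  refine Finset.sum_le_sum fun l' hl' => ?_
  by_cases h : ∃ l, l' = e :: l ∧ e ∉ l
  · obtain ⟨l, rfl, hel⟩ := h
    have hlen : l.length = m := by simpa using length_of_mem_chains hl'
    have := labelLaw_inter_sorted_le (measurable_pi_apply e hJ) l fun π hπ U => by
      simp [hπ e hel]
    rw [show labelLaw _ ((fun U : Config d => U e) ⁻¹' J) = unif J from labelLaw_eval_mem hJ e,
      hlen] at this
    simp only [List.head?_cons, if_true]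
    refine le_trans (measure_mono ?_) this
    rintro U ⟨l₁, h1, -, h2, h3⟩
    obtain rfl : l = l₁ := (List.cons.inj h1).2
    exact ⟨h2, h3⟩
  · have : X l' = ∅ := Set.eq_empty_iff_forall_notMem.2 fun U ⟨l, h1, h2, _⟩ => h ⟨l, h1, h2⟩
    rw [this, measure_empty]
    exact zero_le

theorem measurableSet_of_finite_data {Ω ι : Type*} [MeasurableSpace Ω] [Finite ι]
    {Q : ι → Ω → Prop} (hQ : ∀ i, MeasurableSet {U | Q i U}) {A : Set Ω}
    (hA : ∀ U V, (∀ i, Q i U → Q i V) → (∀ i, Q i V → Q i U) → U ∈ A → V ∈ A) :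
    MeasurableSet A := by
  have hF : Measurable fun (U : Ω) (i : ι) => Q i U :=
    measurable_pi_iff.2 fun i => measurableSet_setOfPred.1 (hQ i)
  have : A = (fun (U : Ω) (i : ι) => Q i U) ⁻¹' ((fun (U : Ω) (i : ι) => Q i U) '' A) := by
    refine (Set.subset_preimage_image _ _).antisymm ?_
    rintro V ⟨U, hU, h⟩
    have h' : ∀ i, Q i U = Q i V := fun i => congrFun h i
    exact hA U V (fun i => (h' i).mp) (fun i => (h' i).mpr) hU
  rw [this]
  exact hF (Set.toFinite _).measurableSet

theorem measurableSet_stage (κ k : ℕ) (e : Sym2 (Vertex d)) :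
    MeasurableSet {U : Config d | stage κ U k e} := by
  induction k generalizing e with
  | zero => simp [stage]
  | succ k ih =>
    have : {U : Config d | stage κ U (k + 1) e} = ⋂ v ∈ {v | v ∈ e}, {U |
        Set.ncard {f : Sym2 (Vertex d) | IsNNEdge f ∧ v ∈ f ∧ f ≠ e ∧ U f < U e ∧ stage κ U k f}
          < κ} := by
      ext U
      simp [stage]
    rw [this]
    refine .biInter (Set.to_countable _) fun v _ => ?_
    refine measurableSet_lt (measurable_ncard.comp (measurable_set_iff.2 fun f => ?_))
      measurable_const
    refine measurableSet_setOfPred.1 ?_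
    exact (MeasurableSet.const _).inter ((MeasurableSet.const _).inter ((MeasurableSet.const _).inter
      ((measurableSet_lt (measurable_pi_apply f) (measurable_pi_apply e)).inter (ih f))))

theorem measurableSet_everOpen (κ : ℕ) (e : Sym2 (Vertex d)) :
    MeasurableSet {U : Config d | everOpen κ U e} := by
  have : {U : Config d | everOpen κ U e} = ⋃ K, ⋂ k, ⋂ (_ : K ≤ k), {U | stage κ U k e} := by
    ext U
    simp [everOpen]
  rw [this]
  exact .iUnion fun K => .iInter fun k => .iInter fun _ => measurableSet_stage κ k e

/-- A measurable version of the one-arm event. -/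
def armSet (d κ n : ℕ) (q : ℝ) : Set (Config d) :=
  {U | Arm n (fun e => IsNNEdge e ∧ U e ≤ q ∧ everOpen κ U e) (fun e => U e ≤ q)
    (fun f e => U f < U e)}

theorem mem_armSet {U : Config d} {q : ℝ} : U ∈ armSet d κ n q ↔
    Arm n (fun e => IsNNEdge e ∧ U e ≤ q ∧ everOpen κ U e) (fun e => U e ≤ q)
      (fun f e => U f < U e) := Iff.rfl

theorem mem_armSet_iff {U : Config d} (hU : WellFounded (earlier U)) {q : ℝ} :
    U ∈ armSet d κ n q ↔ modifiedOneArm κ n q U := by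
  rw [modifiedOneArm_iff_arm, mem_armSet]
  constructor
  · exact fun h => h.mono (fun e _ he => (openEdge_iff hU).2 he) (fun _ _ => id)
      fun _ _ _ _ _ _ => id
  · exact fun h => h.mono (fun e _ he => (openEdge_iff hU).1 he) (fun _ _ => id)
      fun _ _ _ _ _ _ => id

theorem armSet_mono {a b : ℝ} (hab : a ≤ b) : armSet d κ n a ⊆ armSet d κ n b := fun _ h =>
  mem_armSet.2 <| (mem_armSet.1 h).mono (fun _ _ ⟨h1, h2, h3⟩ => ⟨h1, h2.trans hab, h3⟩)
    (fun _ _ h' => h'.trans hab)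
    fun _ _ _ _ _ _ => id

theorem measurableSet_armSet (d κ n : ℕ) (q : ℝ) : MeasurableSet (armSet d κ n q) := by
  let B := {e // e ∈ boxEdges d n}
  let Q : B ⊕ B ⊕ (B × B) → Config d → Prop := fun i U =>
    i.elim (fun e => everOpen κ U e.1) fun i => i.elim (fun e => U e.1 ≤ q)
      fun z => U z.1.1 < U z.2.1
  refine measurableSet_of_finite_data (Q := Q) ?_ fun U V h _ hU => ?_
  · rintro (e | e | z)
    · exact measurableSet_everOpen κ e.1
    · exact measurableSet_le (measurable_pi_apply _) measurable_const
    · exact measurableSet_lt (measurable_pi_apply _) (measurable_pi_apply _)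
  · exact mem_armSet.2 <| (mem_armSet.1 hU).mono
      (fun e he ⟨h1, h2, h3⟩ => ⟨h1, h (.inr (.inl ⟨e, he⟩)) h2, h (.inl ⟨e, he⟩) h3⟩)
      (fun e he h' => h (.inr (.inl ⟨e, he⟩)) h')
      fun e he f hf _ _ h' => h (.inr (.inr (⟨f, hf⟩, ⟨e, he⟩))) h'

theorem tau_eq {κ n : ℕ} (q : ℝ) :
    tau κ (labelLaw (Sym2 (Vertex d))) n q = (labelLaw _ (armSet d κ n q)).toReal := by
  unfold tau
  congr 1
  refine measure_congr ?_
  filter_upwards [ae_regular] with U hU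
  exact propext ((and_iff_right hU.mem_goodConfigs).trans (mem_armSet_iff hU.wf).symm)

/-- Lowering the label of `e` from `1` to `p` changes the one-arm event. -/
def flipSet (d κ n : ℕ) (p : ℝ) (e : Sym2 (Vertex d)) : Set (Config d) := by
  classical exact {U | ¬ (Function.update U e 1 ∈ armSet d κ n p ↔
    Function.update U e p ∈ armSet d κ n p)}

theorem measurableSet_flipSet (p : ℝ) (e : Sym2 (Vertex d)) :
    MeasurableSet (flipSet d κ n p e) := by
  classical
  have hu : ∀ q : ℝ, Measurable fun U : Config d => Function.update U e q := fun q =>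
    (measurable_update_pair e).comp (measurable_const.prodMk measurable_id)
  have hq : ∀ q : ℝ, MeasurableSet {U : Config d | Function.update U e q ∈ armSet d κ n p} :=
    fun q => hu q (measurableSet_armSet d κ n p)
  exact ((measurableSet_setOfPred.1 (hq 1)).iff (measurableSet_setOfPred.1 (hq p))).setOf.compl

theorem labelLaw_inter_flipSet {J : Set ℝ} (hJ : MeasurableSet J) (p : ℝ) (e : Sym2 (Vertex d)) :
    labelLaw _ ({U | U e ∈ J} ∩ flipSet d κ n p e) = unif J * labelLaw _ (flipSet d κ n p e) := by
  classical
  exact labelLaw_inter_of_update_iff hJ (measurableSet_flipSet p e) fun U u => by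
    simp [flipSet, Function.update_idem]

/-- The generic configurations with respect to `p`. -/
structure Generic (p : ℝ) (U : Config d) : Prop extends Regular U where
  ne : ∀ e, U e ≠ p
  ne_one : ∀ e, U e ≠ 1

theorem ae_generic (p : ℝ) : ∀ᵐ U ∂labelLaw (Sym2 (Vertex d)), Generic p U := by
  filter_upwards [ae_regular, ae_ne p, ae_ne 1] with U h1 h2 h3
  exact ⟨h1, h2, h3⟩

theorem Generic.mem_flipSet_iff {p : ℝ} {U : Config d} (hU : Generic p U) (e : Sym2 (Vertex d)) :
    U ∈ flipSet d κ n p e ↔ ¬ (modifiedOneArm κ n p (Function.update U e 1) ↔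
      modifiedOneArm κ n p (Function.update U e p)) := by
  rw [← mem_armSet_iff (wellFounded_earlier_update hU.wf e 1),
    ← mem_armSet_iff (wellFounded_earlier_update hU.wf e p)]
  unfold flipSet
  rw [Set.mem_ofPred_eq]

theorem unif_Ioc {a b : ℝ} (ha : 0 ≤ a) (hb : b ≤ 1) :
    unif (Set.Ioc a b) = ENNReal.ofReal (b - a) := by
  rw [unif, Measure.restrict_apply measurableSet_Ioc, Set.inter_eq_left.2, Real.volume_Ioc]
  exact fun x hx => ⟨ha.trans hx.1.le, hx.2.trans hb⟩

theorem unif_Ioi {p : ℝ} (hp : 0 ≤ p) : unif (Set.Ioi p) = ENNReal.ofReal (1 - p) := by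
  rw [← Real.volume_Ioc, unif, Measure.restrict_apply measurableSet_Ioi]
  congr 1
  ext x
  simp only [Set.mem_inter_iff, Set.mem_Ioi, Set.mem_Icc, Set.mem_Ioc]
  exact ⟨fun h => ⟨h.1, h.2.2⟩, fun h => ⟨h.1, hp.trans h.1.le, h.2⟩⟩

theorem labelLaw_pPivotal {p : ℝ} (hp : p ∈ Set.Ico (0 : ℝ) 1) (e : Sym2 (Vertex d)) :
    labelLaw _ {U | pPivotal κ n p e U} =
      ENNReal.ofReal (1 - p) * labelLaw _ (flipSet d κ n p e) := by
  rw [← unif_Ioi hp.1, ← labelLaw_inter_flipSet measurableSet_Ioi]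
  refine measure_congr ?_
  filter_upwards [ae_generic p] with U hU
  refine propext ?_
  show pPivotal κ n p e U ↔ p < U e ∧ U ∈ flipSet d κ n p e
  rw [hU.mem_flipSet_iff, pPivotal]
  refine (and_iff_right hU.mem_goodConfigs).trans (and_congr_right fun hpe => ?_)
  refine (and_iff_right ?_).trans ?_
  · exact (hU.update ⟨hp.1, hp.2.le⟩ fun f _ => hU.ne f).mem_goodConfigs
  · rw [modifiedOneArm_iff_update_one_of_lt hU.toRegular hp.2 hpe]

theorem labelLaw_flipSet_le (p : ℝ) (e : Sym2 (Vertex d)) :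
    labelLaw _ (flipSet d κ n p e) ≤ weight n e := by
  have h := labelLaw_relevant_le (n := n) MeasurableSet.univ e
  rw [measure_univ, one_mul] at h
  refine (measure_mono_ae ?_).trans h
  filter_upwards [ae_generic p] with U hU hmem
  refine ⟨trivial, by_contra fun hrel => (hU.mem_flipSet_iff e).1 hmem ?_⟩
  exact modifiedOneArm_update_iff_of_not_relevant hU.toRegular _ _ hrel

theorem Relevant.isNNEdge {U : Config d} {e : Sym2 (Vertex d)} (h : Relevant n U e) :
    IsNNEdge e := by
  rcases h with h | ⟨_, _, h⟩
  exacts [isNNEdge_of_mem_boxEdges h, h.1]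

/-- Two labels of edges in `Λ` belong to `J`. -/
def twoSet (Λ : Finset {e : Sym2 (Vertex d) // IsNNEdge e}) (J : Set ℝ) : Set (Config d) := by
  classical exact ⋃ z ∈ Λ.offDiag, {U | U z.1.1 ∈ J ∧ U z.2.1 ∈ J}

/-- The label of some relevant edge outside `Λ` belongs to `J`. -/
def farSet (n : ℕ) (Λ : Finset {e : Sym2 (Vertex d) // IsNNEdge e}) (J : Set ℝ) :
    Set (Config d) :=
  ⋃ e : {e // e ∉ Λ}, {U | U e.1.1 ∈ J ∧ Relevant n U e.1.1}

theorem eq_of_notMem_twoSet {Λ : Finset {e : Sym2 (Vertex d) // IsNNEdge e}} {J : Set ℝ}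
    {U : Config d} (h : U ∉ twoSet Λ J) {e f : {e : Sym2 (Vertex d) // IsNNEdge e}} (he : e ∈ Λ)
    (hf : f ∈ Λ) (heJ : U e.1 ∈ J) (hfJ : U f.1 ∈ J) : e = f := by
  classical
  by_contra hne
  exact h (Set.mem_biUnion (x := (e, f)) (Finset.mem_coe.2 (Finset.mem_offDiag.2 ⟨he, hf, hne⟩))
    ⟨heJ, hfJ⟩)

theorem mem_of_notMem_farSet {Λ : Finset {e : Sym2 (Vertex d) // IsNNEdge e}} {J : Set ℝ}
    {U : Config d} (h : U ∉ farSet n Λ J) {e : Sym2 (Vertex d)} (he : Relevant n U e)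
    (heJ : U e ∈ J) : ⟨e, he.isNNEdge⟩ ∈ Λ := by
  by_contra hne
  exact h (Set.mem_iUnion.2 ⟨⟨⟨e, he.isNNEdge⟩, hne⟩, heJ, he⟩)

theorem measurableSet_twoSet (Λ : Finset {e : Sym2 (Vertex d) // IsNNEdge e}) {J : Set ℝ}
    (hJ : MeasurableSet J) : MeasurableSet (twoSet Λ J) := by
  classical
  exact Finset.measurableSet_biUnion _ fun z _ =>
    (measurable_pi_apply z.1.1 hJ).inter (measurable_pi_apply z.2.1 hJ)

theorem labelLaw_twoSet_le (Λ : Finset {e : Sym2 (Vertex d) // IsNNEdge e}) {J : Set ℝ}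
    (hJ : MeasurableSet J) : labelLaw _ (twoSet Λ J) ≤ (Λ.card : ENNReal) ^ 2 * unif J ^ 2 := by
  classical
  calc labelLaw _ (twoSet Λ J)
      ≤ ∑ z ∈ Λ.offDiag, labelLaw _ {U | U z.1.1 ∈ J ∧ U z.2.1 ∈ J} :=
        measure_biUnion_finset_le _ _
    _ = ∑ z ∈ Λ.offDiag, unif J ^ 2 := by
        refine Finset.sum_congr rfl fun z hz => ?_
        rw [labelLaw_pair (fun h => (Finset.mem_offDiag.1 hz).2.2 (Subtype.ext h)) hJ, sq]
    _ ≤ _ := by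
        rw [Finset.sum_const, nsmul_eq_mul, Finset.offDiag_card]
        gcongr
        rw [sq]
        exact_mod_cast Nat.sub_le _ _

theorem labelLaw_farSet_le (Λ : Finset {e : Sym2 (Vertex d) // IsNNEdge e}) {J : Set ℝ}
    (hJ : MeasurableSet J) :
    labelLaw _ (farSet n Λ J) ≤ unif J * ∑' e : {e // e ∉ Λ}, weight n e.1.1 := by
  rw [← ENNReal.tsum_mul_left]
  exact (measure_iUnion_le _).trans (ENNReal.tsum_le_tsum fun e => labelLaw_relevant_le hJ _)

section Increment

variable {a b p : ℝ}

theorem Generic.mem_armSet_diff_iff {U : Config d} (hU : Generic p U) (hap : a ≤ p) (hpb : p ≤ b)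
    (hp : p < 1) {Λ : Finset {e : Sym2 (Vertex d) // IsNNEdge e}}
    (htwo : U ∉ twoSet Λ (Set.Ioc a b)) (hfar : U ∉ farSet n Λ (Set.Ioc a b)) :
    U ∈ armSet d κ n b \ armSet d κ n a ↔
      ∃ e ∈ Λ, U e.1 ∈ Set.Ioc a b ∧ U ∈ flipSet d κ n p e.1 := by
  have hmono : modifiedOneArm κ n a U → modifiedOneArm κ n b U :=
    modifiedOneArm_mono (hap.trans hpb)
  have hD : U ∈ armSet d κ n b \ armSet d κ n a ↔
      ¬ (modifiedOneArm κ n a U ↔ modifiedOneArm κ n b U) := by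
    rw [Set.mem_sdiff, mem_armSet_iff hU.wf, mem_armSet_iff hU.wf]
    tauto
  rw [hD]
  by_cases hex : ∃ e ∈ Λ, U e.1 ∈ Set.Ioc a b
  · obtain ⟨e, heΛ, he⟩ := hex
    have h : ∀ f, Relevant n U f → U f ∈ Set.Ioc a b → f = e.1 := fun f hf hfJ =>
      congrArg Subtype.val
        (eq_of_notMem_twoSet htwo (mem_of_notMem_farSet hfar hf hfJ) heΛ hfJ he)
    rw [modifiedOneArm_iff_update_one hU.toRegular hap hpb hp he h,
      modifiedOneArm_iff_update_self hU.toRegular hap hpb (fun f _ => hU.ne f) he h,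
      ← hU.mem_flipSet_iff]
    constructor
    · exact fun h' => ⟨e, heΛ, he, h'⟩
    · rintro ⟨f, hfΛ, hf, h'⟩
      rwa [eq_of_notMem_twoSet htwo heΛ hfΛ he hf]
  · have := modifiedOneArm_iff_of_forall_notMem (κ := κ) hU.wf (hap.trans hpb)
      fun e he heJ => hex ⟨_, mem_of_notMem_farSet hfar he heJ, heJ⟩
    simp only [this, not_true, false_iff]
    rintro ⟨e, heΛ, he, -⟩
    exact hex ⟨e, heΛ, he⟩

theorem labelLaw_armSet_diff_le (hap : a ≤ p) (hpb : p ≤ b) (hp : p < 1)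
    (Λ : Finset {e : Sym2 (Vertex d) // IsNNEdge e}) :
    labelLaw _ (armSet d κ n b \ armSet d κ n a) ≤
      unif (Set.Ioc a b) * ∑ e ∈ Λ, labelLaw _ (flipSet d κ n p e.1) +
        labelLaw _ (twoSet Λ (Set.Ioc a b)) + labelLaw _ (farSet n Λ (Set.Ioc a b)) := by
  rw [Finset.mul_sum,
    ← Finset.sum_congr rfl fun e _ => labelLaw_inter_flipSet measurableSet_Ioc p e.1]
  calc labelLaw _ (armSet d κ n b \ armSet d κ n a)
      ≤ labelLaw _ ((⋃ e ∈ Λ, {U | U e.1 ∈ Set.Ioc a b} ∩ flipSet d κ n p e.1) ∪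
          twoSet Λ (Set.Ioc a b) ∪ farSet n Λ (Set.Ioc a b)) := by
        refine measure_mono_ae ?_
        filter_upwards [ae_generic p] with U hU hmem
        by_contra hnot
        obtain ⟨hnot, hfar⟩ := not_or.1 hnot
        obtain ⟨hnot, htwo⟩ := not_or.1 hnot
        obtain ⟨e, heΛ, he⟩ := (hU.mem_armSet_diff_iff hap hpb hp htwo hfar).1 hmem
        exact hnot (Set.mem_biUnion heΛ he)
    _ ≤ _ := (measure_union_le _ _).trans (add_le_add_left ((measure_union_le _ _).trans
        (add_le_add_left (measure_biUnion_finset_le _ _) _)) _)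

theorem le_labelLaw_armSet_diff (hap : a ≤ p) (hpb : p ≤ b) (hp : p < 1)
    (Λ : Finset {e : Sym2 (Vertex d) // IsNNEdge e}) :
    unif (Set.Ioc a b) * ∑ e ∈ Λ, labelLaw _ (flipSet d κ n p e.1) ≤
      labelLaw _ (armSet d κ n b \ armSet d κ n a) +
        labelLaw _ (farSet n Λ (Set.Ioc a b)) + Λ.card * labelLaw _ (twoSet Λ (Set.Ioc a b)) := by
  rw [Finset.mul_sum,
    ← Finset.sum_congr rfl fun e _ => labelLaw_inter_flipSet measurableSet_Ioc p e.1]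
  have hm := measurableSet_twoSet Λ (measurableSet_Ioc (a := a) (b := b))
  calc ∑ e ∈ Λ, labelLaw _ ({U | U e.1 ∈ Set.Ioc a b} ∩ flipSet d κ n p e.1)
      ≤ ∑ e ∈ Λ, (labelLaw _ (({U | U e.1 ∈ Set.Ioc a b} ∩ flipSet d κ n p e.1) \
          twoSet Λ (Set.Ioc a b)) + labelLaw _ (twoSet Λ (Set.Ioc a b))) :=
        Finset.sum_le_sum fun e _ => (measure_mono fun U hU => by
          by_cases h : U ∈ twoSet Λ (Set.Ioc a b)
          exacts [Or.inr h, Or.inl ⟨hU, h⟩]).trans (measure_union_le _ _)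
    _ = labelLaw _ (⋃ e ∈ Λ, ({U | U e.1 ∈ Set.Ioc a b} ∩ flipSet d κ n p e.1) \
          twoSet Λ (Set.Ioc a b)) + Λ.card * labelLaw _ (twoSet Λ (Set.Ioc a b)) := by
        rw [Finset.sum_add_distrib, Finset.sum_const, nsmul_eq_mul, measure_biUnion_finset]
        · intro e he f hf hne
          refine Set.disjoint_left.2 fun U h1 h2 => hne ?_
          exact eq_of_notMem_twoSet h1.2 he hf h1.1.1 h2.1.1
        · exact fun e _ => ((measurable_pi_apply e.1 measurableSet_Ioc).inter
            (measurableSet_flipSet p e.1)).diff hm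
    _ ≤ _ := by
        refine add_le_add_left ((measure_mono_ae ?_).trans (measure_union_le _ _)) _
        filter_upwards [ae_generic p] with U hU hmem
        obtain ⟨e, heΛ, he, htwo⟩ := Set.mem_iUnion₂.1 hmem
        by_cases hfar : U ∈ farSet n Λ (Set.Ioc a b)
        · exact Or.inr hfar
        · exact Or.inl ((hU.mem_armSet_diff_iff hap hpb hp htwo hfar).2 ⟨e, heΛ, he⟩)

theorem tsum_flipSet_le (n : ℕ) (p : ℝ) (Λ : Finset {e : Sym2 (Vertex d) // IsNNEdge e}) :
    ∑' e : {e : Sym2 (Vertex d) // IsNNEdge e}, labelLaw _ (flipSet d κ n p e.1) ≤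
      ∑ e ∈ Λ, labelLaw _ (flipSet d κ n p e.1) + ∑' e : {e // e ∉ Λ}, weight n e.1.1 := by
  rw [← ENNReal.sum_add_tsum_compl Λ]
  exact add_le_add_right (ENNReal.tsum_le_tsum fun _ => labelLaw_flipSet_le p _) _

theorem tsum_subtype_weight_ne_top (d n : ℕ) :
    ∑' e : {e : Sym2 (Vertex d) // IsNNEdge e}, weight n e.1 ≠ ⊤ :=
  ne_top_of_le_ne_top (tsum_weight_ne_top d n)
    (ENNReal.tsum_comp_le_tsum_of_injective Subtype.val_injective _)

theorem tsum_flipSet_ne_top (d κ n : ℕ) (p : ℝ) :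
    ∑' e : {e : Sym2 (Vertex d) // IsNNEdge e}, labelLaw _ (flipSet d κ n p e.1) ≠ ⊤ :=
  ne_top_of_le_ne_top (tsum_subtype_weight_ne_top d n)
    (ENNReal.tsum_le_tsum fun _ => labelLaw_flipSet_le p _)

theorem abs_tau_sub_le (d κ n : ℕ) {p : ℝ} (hp : p < 1) {ε : ℝ} (hε : 0 ≤ ε)
    {Λ : Finset {e : Sym2 (Vertex d) // IsNNEdge e}}
    (hΛ : ∑' e : {e // e ∉ Λ}, weight n e.1.1 ≤ ENNReal.ofReal ε)
    (ha : 0 ≤ a) (hap : a ≤ p) (hpb : p ≤ b) (hb : b ≤ 1) :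
    |tau κ (labelLaw (Sym2 (Vertex d))) n b - tau κ (labelLaw (Sym2 (Vertex d))) n a -
      (b - a) * (∑' e : {e : Sym2 (Vertex d) // IsNNEdge e},
        labelLaw _ (flipSet d κ n p e.1)).toReal| ≤
      2 * ε * (b - a) + (Λ.card + 1) * Λ.card ^ 2 * (b - a) ^ 2 := by
  set T := ∑' e : {e : Sym2 (Vertex d) // IsNNEdge e}, labelLaw _ (flipSet d κ n p e.1)
  set D := labelLaw _ (armSet d κ n b \ armSet d κ n a) with hD
  have hTtop : T ≠ ⊤ := tsum_flipSet_ne_top d κ n p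
  have hDtop : D ≠ ⊤ := measure_ne_top _ _
  have hh : 0 ≤ b - a := by linarith
  have htau : tau κ (labelLaw (Sym2 (Vertex d))) n b - tau κ (labelLaw (Sym2 (Vertex d))) n a =
      D.toReal := by
    rw [tau_eq, tau_eq, hD, measure_sdiff (armSet_mono (hap.trans hpb))
      (measurableSet_armSet d κ n a).nullMeasurableSet (measure_ne_top _ _),
      ENNReal.toReal_sub_of_le (measure_mono (armSet_mono (hap.trans hpb))) (measure_ne_top _ _)]
  have htwo := labelLaw_twoSet_le Λ (measurableSet_Ioc (a := a) (b := b))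
  have hfar := (labelLaw_farSet_le (n := n) Λ (measurableSet_Ioc (a := a) (b := b))).trans
    (mul_le_mul_right hΛ _)
  have hupper := labelLaw_armSet_diff_le (κ := κ) (n := n) hap hpb hp Λ
  have hlower := le_labelLaw_armSet_diff (κ := κ) (n := n) hap hpb hp Λ
  have hsT : ∑ e ∈ Λ, labelLaw _ (flipSet d κ n p e.1) ≤ T := ENNReal.sum_le_tsum Λ
  have hTs := (tsum_flipSet_le (κ := κ) n p Λ).trans (add_le_add_right hΛ _)
  rw [unif_Ioc ha hb] at htwo hfar hupper hlower
  set h := ENNReal.ofReal (b - a)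
  have h1 : D ≤ h * T + Λ.card ^ 2 * h ^ 2 + h * ENNReal.ofReal ε :=
    hupper.trans (by gcongr)
  have h2 : h * T ≤ D + h * ENNReal.ofReal ε + Λ.card * (Λ.card ^ 2 * h ^ 2) +
      h * ENNReal.ofReal ε := by
    refine (mul_le_mul_right hTs h).trans ?_
    rw [mul_add]
    exact add_le_add_left (hlower.trans (by gcongr)) _
  have hcard : (Λ.card : ENNReal) = ENNReal.ofReal Λ.card := (ENNReal.ofReal_natCast _).symm
  rw [← ENNReal.ofReal_toReal hTtop, ← ENNReal.ofReal_toReal hDtop, hcard] at h1 h2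
  have hDn := ENNReal.toReal_nonneg (a := D)
  have hTn := ENNReal.toReal_nonneg (a := T)
  rw [← ENNReal.ofReal_pow (by positivity), ← ENNReal.ofReal_pow hh, ← ENNReal.ofReal_mul hh,
    ← ENNReal.ofReal_mul (by positivity), ← ENNReal.ofReal_mul hh,
    ← ENNReal.ofReal_add (by positivity) (by positivity),
    ← ENNReal.ofReal_add (by positivity) (by positivity),
    ENNReal.ofReal_le_ofReal_iff (by positivity)] at h1
  rw [← ENNReal.ofReal_pow (by positivity), ← ENNReal.ofReal_pow hh, ← ENNReal.ofReal_mul hh,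
    ← ENNReal.ofReal_mul hh, ← ENNReal.ofReal_mul (by positivity),
    ← ENNReal.ofReal_mul (by positivity),
    ← ENNReal.ofReal_add (by positivity) (by positivity),
    ← ENNReal.ofReal_add (by positivity) (by positivity),
    ← ENNReal.ofReal_add (by positivity) (by positivity),
    ENNReal.ofReal_le_ofReal_iff (by positivity)] at h2
  rw [htau, abs_le]
  have h3 : 0 ≤ (Λ.card : ℝ) ^ 2 * (b - a) ^ 2 := by positivity
  have h4 : 0 ≤ (Λ.card : ℝ) * (Λ.card ^ 2 * (b - a) ^ 2) := by positivity
  have h5 : 0 ≤ (b - a) * ε := by positivity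
  constructor <;> nlinarith

end Increment

theorem hasDerivWithinAt_tau (d κ n : ℕ) {p : ℝ} (hp : p ∈ Set.Ico (0 : ℝ) 1) :
    HasDerivWithinAt (fun q => tau κ (labelLaw (Sym2 (Vertex d))) n q)
      (∑' e : {e : Sym2 (Vertex d) // IsNNEdge e}, labelLaw _ (flipSet d κ n p e.1)).toReal
      (Set.Icc 0 1) p := by
  rw [hasDerivWithinAt_iff_isLittleO, Asymptotics.isLittleO_iff]
  intro c hc
  obtain ⟨Λ, hΛ⟩ := ((ENNReal.tendsto_tsum_compl_atTop_zero
    (tsum_subtype_weight_ne_top d n)).eventually_le_const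
      (ENNReal.ofReal_pos.2 (show 0 < c / 4 by positivity))).exists
  set M : ℝ := (Λ.card + 1) * Λ.card ^ 2
  have hM : 0 ≤ M := by positivity
  have hnear : ∀ᶠ q in nhdsWithin p (Set.Icc 0 1), |q - p| < c / (2 * (M + 1)) :=
    nhdsWithin_le_nhds (Metric.ball_mem_nhds p (by positivity))
  filter_upwards [hnear, self_mem_nhdsWithin] with q hq hqmem
  have hmain : ‖tau κ (labelLaw (Sym2 (Vertex d))) n q - tau κ (labelLaw (Sym2 (Vertex d))) n p -
      (q - p) • (∑' e : {e : Sym2 (Vertex d) // IsNNEdge e},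
        labelLaw _ (flipSet d κ n p e.1)).toReal‖ ≤
      2 * (c / 4) * |q - p| + M * |q - p| ^ 2 := by
    rcases le_total p q with hpq | hqp
    · rw [abs_of_nonneg (sub_nonneg.2 hpq)]
      exact abs_tau_sub_le d κ n hp.2 (by positivity) hΛ hp.1 le_rfl hpq hqmem.2
    · rw [abs_sub_comm, abs_of_nonneg (sub_nonneg.2 hqp), ← norm_neg]
      have := abs_tau_sub_le d κ n hp.2 (by positivity) hΛ hqmem.1 hqp le_rfl hp.2.le
      convert this using 2
      rw [Real.norm_eq_abs, smul_eq_mul]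
      ring_nf
  refine hmain.trans ?_
  rw [Real.norm_eq_abs]
  have h1 : M * |q - p| ≤ c / 2 := by
    rw [lt_div_iff₀ (by positivity)] at hq
    nlinarith [abs_nonneg (q - p)]
  nlinarith [abs_nonneg (q - p)]

end

/-- **Russo formula**: for every `n ≥ 1`, `τ_n` is differentiable on `[0,1)` (as a function
on the domain `[0,1]`) with derivative `(1/(1-p)) Σ_{e ∈ 𝓔} ℙ(e is p-pivotal)`. -/
theorem russo_formula (d κ : ℕ) (hd : 2 ≤ d) (hκ₁ : 2 ≤ κ) (hκ₂ : κ ≤ 2 * d)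
    (P : Measure (Config d)) (hP : IsProductUniform P)
    (n : ℕ) (hn : 1 ≤ n) (p : ℝ) (hp : p ∈ Set.Ico (0 : ℝ) 1) :
    HasDerivWithinAt (fun q => tau κ P n q)
      ((1 / (1 - p)) * ∑' e : {e : Sym2 (Vertex d) // IsNNEdge e},
        (P {U | pPivotal κ n p e.1 U}).toReal)
      (Set.Icc 0 1) p := by
  rw [hP.eq_labelLaw]
  convert hasDerivWithinAt_tau d κ n hp using 1
  have h1 : 0 < 1 - p := sub_pos.2 hp.2
  rw [ENNReal.tsum_toReal_eq fun e => measure_ne_top _ _]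
  simp only [labelLaw_pPivotal hp, ENNReal.toReal_mul, ENNReal.toReal_ofReal h1.le]
  rw [tsum_mul_left, ← mul_assoc, one_div_mul_cancel h1.ne', one_mul]

end CDP
end

section
/- Fix U ∈ Ω ∩ (0,1)^𝓔, p ∈ (0,1), and e ∈ 𝓔. Define U^{e+} by U^{e+}_f = U_f for all f ≠ e and U^{e+}_e = 0, and U^{e−} by U^{e−}_f = U_f for all f ≠ e and U^{e−}_e = 1. Then ω_p(U) ∈ {ω_p(U^{e+}), ω_p(U^{e−})}. Moreover, the set of edges f ∈ 𝓔 with ω_p(U^{e+},f) ≠ ω_p(U^{e−},f) is the edge set of a path 𝓟_e containing e, whose two endpoints may coincide but which has no other self-intersections. Finally, if 𝓟_e = x_1,…,x_m with e = x_i x_{i+1}, then the paths x_1,…,x_i and x_m,…,x_{i+1} are both decreasing. -/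
open MeasureTheory

namespace CDP

/-- No infinite walk has strictly decreasing labels. -/
def NoDescendingWalk {d : ℕ} (V : Config d) : Prop :=
  ¬ ∃ w : ℕ → Vertex d, (∀ i, adj (w i) (w (i + 1))) ∧
    StrictAnti (fun i => V s(w i, w (i + 1)))

/-- The directed edge `a` continues the directed edge `b`, with a smaller label. -/
def Continues {d : ℕ} (V : Config d) (a b : Vertex d × Vertex d) : Prop :=
  a.1 = b.2 ∧ adj a.1 a.2 ∧ V s(a.1, a.2) < V s(b.1, b.2)

/-- `f` is an edge sharing a vertex with `g` and carrying a smaller label. -/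
def EarlierNeighbour {d : ℕ} (V : Config d) (f g : Sym2 (Vertex d)) : Prop :=
  IsNNEdge f ∧ (∃ v, v ∈ f ∧ v ∈ g) ∧ V f < V g

lemma adj_symm {d : ℕ} {x y : Vertex d} (h : adj x y) : adj y x := by
  unfold adj at *
  simpa only [abs_sub_comm] using h

lemma isNNEdge_mk {d : ℕ} {x y : Vertex d} : IsNNEdge s(x, y) ↔ adj x y := by
  constructor
  · rintro ⟨a, b, hab, h⟩
    rcases Sym2.eq_iff.1 h with ⟨rfl, rfl⟩ | ⟨rfl, rfl⟩
    · exact hab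
    · exact adj_symm hab
  · exact fun h => ⟨x, y, h, rfl⟩

lemma IsNNEdge.exists_eq_mk {d : ℕ} {f : Sym2 (Vertex d)} {v : Vertex d} (hf : IsNNEdge f)
    (hv : v ∈ f) : ∃ w, adj v w ∧ f = s(v, w) := by
  obtain ⟨w, rfl⟩ := hv
  exact ⟨w, isNNEdge_mk.1 hf, rfl⟩

lemma not_adj_self {d : ℕ} (x : Vertex d) : ¬ adj x x := by simp [adj]

lemma finite_edges_at {d : ℕ} (v : Vertex d) : {f | IsNNEdge f ∧ v ∈ f}.Finite := by
  refine ((Set.finite_Icc (v - 1) (v + 1)).image (fun w => s(v, w))).subset ?_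
  rintro f ⟨hf, hv⟩
  obtain ⟨w, hw, rfl⟩ := hf.exists_eq_mk hv
  refine ⟨w, ?_, rfl⟩
  have key : ∀ i, |v i - w i| ≤ 1 := fun i => by
    have := Finset.single_le_sum (f := fun i => |v i - w i|) (fun i _ => abs_nonneg _)
      (Finset.mem_univ i)
    unfold adj at hw
    simpa only [hw] using this
  constructor <;> intro i <;> have := abs_le.1 (key i) <;>
    simp only [Pi.sub_apply, Pi.add_apply, Pi.one_apply] <;> omega

/-- Adjacent vertices have coordinate sums of different parity. -/
lemma even_sum_of_adj {d : ℕ} {x y : Vertex d} (h : adj x y) :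
    Even (∑ i, y i) ↔ ¬ Even (∑ i, x i) := by
  have h1 : Even (∑ i, |x i - y i|) ↔ Even (∑ i, (x i - y i)) := by
    rw [← Int.even_sub, ← Finset.sum_sub_distrib]
    refine Finset.even_sum _ fun i _ => ?_
    rw [Int.even_sub, even_abs]
  unfold adj at h
  rw [h, Finset.sum_sub_distrib, Int.even_sub] at h1
  have h2 : ¬ Even (1 : ℤ) := by decide
  tauto

lemma NoDescendingWalk.of_eq_off {d : ℕ} {U V : Config d} (hU : NoDescendingWalk U)
    {e : Sym2 (Vertex d)} (h : ∀ f, f ≠ e → V f = U f) : NoDescendingWalk V := by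
  rintro ⟨w, hw, hV⟩
  obtain ⟨N, hN⟩ : ∃ N, ∀ i, N ≤ i → s(w i, w (i + 1)) ≠ e := by
    by_cases hex : ∃ i, s(w i, w (i + 1)) = e
    · obtain ⟨i, hi⟩ := hex
      refine ⟨i + 1, fun j hj hje => ?_⟩
      have := hV.injective (a₁ := i) (a₂ := j) (by simp only [hi, hje])
      omega
    · exact ⟨0, fun i _ hi => hex ⟨i, hi⟩⟩
  refine hU ⟨fun i => w (N + i), fun i => hw _, strictAnti_nat_of_succ_lt fun i => ?_⟩
  have := hV (show N + i < N + (i + 1) by omega)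
  simp only at this
  rwa [h _ (hN _ (by omega)), h _ (hN _ (by omega))] at this

lemma wellFounded_continues {d : ℕ} {V : Config d} (hV : NoDescendingWalk V) :
    WellFounded (Continues V) := by
  rw [wellFounded_iff_isEmpty_descending_chain]
  refine ⟨fun ⟨f, hf⟩ => hV ⟨fun i => (f (i + 1)).1, fun i => ?_,
    strictAnti_nat_of_succ_lt fun i => ?_⟩⟩
  · show adj (f (i + 1)).1 (f (i + 1 + 1)).1
    rw [(hf (i + 1)).1]
    exact (hf i).2.1
  · simp only [(hf (i + 1)).1, (hf (i + 2)).1]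
    have := (hf (i + 1)).2.2
    rwa [(hf (i + 1)).1] at this

lemma wellFounded_earlierNeighbour {d : ℕ} {V : Config d} (hV : NoDescendingWalk V) :
    WellFounded (EarlierNeighbour V) := by
  have key : ∀ a : Vertex d × Vertex d, ∀ f, IsNNEdge f → a.2 ∈ f → V f < V s(a.1, a.2) →
      Acc (EarlierNeighbour V) f := by
    intro a
    induction a using (wellFounded_continues hV).induction with
    | _ a ih =>
      obtain ⟨x, y⟩ := a
      simp only at ih ⊢
      have hwf : Set.WellFoundedOn {f | IsNNEdge f ∧ y ∈ f} (fun f g => V f < V g) :=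
        (finite_edges_at y).wellFoundedOn (r := fun f g => V f < V g)
      intro f hf hy hlt
      refine hwf.induction (P := fun f => V f < V s(x, y) → Acc (EarlierNeighbour V) f)
        ⟨hf, hy⟩ ?_ hlt
      rintro f ⟨hf, hy⟩ ih' hlt
      obtain ⟨z, hz, rfl⟩ := hf.exists_eq_mk hy
      refine ⟨_, ?_⟩
      rintro g ⟨hg, ⟨v, hvg, hv⟩, hgf⟩
      rcases Sym2.mem_iff.1 hv with rfl | rfl
      · exact ih' g ⟨hg, hvg⟩ hgf (hgf.trans hlt)
      · exact ih (y, v) ⟨rfl, hz, hlt⟩ g hg hvg hgf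
  refine ⟨fun f => ⟨_, ?_⟩⟩
  rintro g ⟨hg, ⟨v, hvg, hv⟩, hgf⟩
  obtain ⟨w, rfl⟩ := hv
  exact key (w, v) g hg hvg (by rwa [Sym2.eq_swap])

lemma exists_consistent {d : ℕ} (κ : ℕ) {V : Config d} (hV : NoDescendingWalk V) :
    ∃ σ, Consistent κ V σ := by
  have hwf := wellFounded_earlierNeighbour hV
  let F : ∀ e, (∀ f, EarlierNeighbour V f e → Prop) → Prop := fun e σ => ∀ v ∈ e,
    Set.ncard {f : Sym2 (Vertex d) | IsNNEdge f ∧ v ∈ f ∧ f ≠ e ∧ V f < V e ∧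
      ∃ h : EarlierNeighbour V f e, σ f h} < κ
  refine ⟨hwf.fix F, fun e _ => ?_⟩
  rw [hwf.fix_eq]
  refine forall₂_congr fun v hv => ?_
  have : {f : Sym2 (Vertex d) | IsNNEdge f ∧ v ∈ f ∧ f ≠ e ∧ V f < V e ∧
      ∃ _ : EarlierNeighbour V f e, hwf.fix F f} =
      {f | IsNNEdge f ∧ v ∈ f ∧ f ≠ e ∧ V f < V e ∧ hwf.fix F f} := by
    ext f
    constructor
    · rintro ⟨h1, h2, h3, h4, -, h5⟩
      exact ⟨h1, h2, h3, h4, h5⟩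
    · rintro ⟨h1, h2, h3, h4, h5⟩
      exact ⟨h1, h2, h3, h4, ⟨h1, ⟨v, h2, hv⟩, h4⟩, h5⟩
  rw [this]

/-- Consistent labellings up to level `p` are determined by the labels up to level `p`. -/
lemma Consistent.iff_of_agree {d κ : ℕ} {V W : Config d} (hV : NoDescendingWalk V) {p : ℝ}
    (hVW : ∀ f, IsNNEdge f → V f ≤ p ∨ W f ≤ p → V f = W f) {σ ρ : Sym2 (Vertex d) → Prop}
    (hσ : Consistent κ V σ) (hρ : Consistent κ W ρ) {f : Sym2 (Vertex d)} (hf : IsNNEdge f)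
    (hfp : V f ≤ p) : σ f ↔ ρ f := by
  induction f using (wellFounded_earlierNeighbour hV).induction with
  | _ f ih =>
    rw [hσ f hf, hρ f hf]
    refine forall₂_congr fun v hv => ?_
    have hfW := hVW f hf (.inl hfp)
    have : {g | IsNNEdge g ∧ v ∈ g ∧ g ≠ f ∧ V g < V f ∧ σ g} =
        {g | IsNNEdge g ∧ v ∈ g ∧ g ≠ f ∧ W g < W f ∧ ρ g} := by
      ext g
      constructor
      · rintro ⟨h1, h2, h3, h4, h5⟩
        have := hVW g h1 (.inl (h4.le.trans hfp))
        exact ⟨h1, h2, h3, by linarith, (ih g ⟨h1, ⟨v, h2, hv⟩, h4⟩ h1 (h4.le.trans hfp)).1 h5⟩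
      · rintro ⟨h1, h2, h3, h4, h5⟩
        have := hVW g h1 (.inr (by linarith))
        have h4' : V g < V f := by linarith
        exact ⟨h1, h2, h3, h4',
          (ih g ⟨h1, ⟨v, h2, hv⟩, h4'⟩ h1 (h4'.le.trans hfp)).2 h5⟩
    rw [this]

lemma openEdge_iff_s2 {d κ : ℕ} {V : Config d} (hV : NoDescendingWalk V) {p : ℝ}
    {σ : Sym2 (Vertex d) → Prop} (hσ : Consistent κ V σ) {f : Sym2 (Vertex d)}
    (hf : IsNNEdge f) : openEdge κ V p f ↔ V f ≤ p ∧ σ f := by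
  constructor
  · rintro ⟨-, hp, ρ, hρ, h⟩
    exact ⟨hp, (hρ.iff_of_agree hV (fun _ _ _ => rfl) hσ hf le_rfl).1 h⟩
  · exact fun h => ⟨hf, h.1, σ, hσ, h.2⟩

/-- Number of edges at `v` with label below `τ` that are selected by `σ`. -/
noncomputable def degreeBefore {d : ℕ} (V : Config d) (σ : Sym2 (Vertex d) → Prop)
    (v : Vertex d) (τ : ℝ) : ℕ :=
  Set.ncard {f | IsNNEdge f ∧ v ∈ f ∧ V f < τ ∧ σ f}

lemma finite_degreeBefore {d : ℕ} (V : Config d) (σ : Sym2 (Vertex d) → Prop)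
    (v : Vertex d) (τ : ℝ) : {f | IsNNEdge f ∧ v ∈ f ∧ V f < τ ∧ σ f}.Finite :=
  (finite_edges_at v).subset fun _ h => ⟨h.1, h.2.1⟩

lemma degreeBefore_mono {d : ℕ} (V : Config d) (σ : Sym2 (Vertex d) → Prop)
    (v : Vertex d) {τ τ' : ℝ} (h : τ ≤ τ') : degreeBefore V σ v τ ≤ degreeBefore V σ v τ' :=
  Set.ncard_le_ncard (fun _ hf => ⟨hf.1, hf.2.1, hf.2.2.1.trans_le h, hf.2.2.2⟩)
    (finite_degreeBefore V σ v τ')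

lemma degreeBefore_succ_le {d : ℕ} {V : Config d} {σ : Sym2 (Vertex d) → Prop}
    {v : Vertex d} {f : Sym2 (Vertex d)} {τ : ℝ} (hf : IsNNEdge f) (hv : v ∈ f) (hσ : σ f)
    (h : V f < τ) : degreeBefore V σ v (V f) + 1 ≤ degreeBefore V σ v τ := by
  unfold degreeBefore
  rw [← Set.ncard_insert_of_notMem (a := f) (fun h => lt_irrefl _ h.2.2.1)
    (finite_degreeBefore V σ v _)]
  refine Set.ncard_le_ncard ?_ (finite_degreeBefore V σ v τ)
  rintro g (rfl | hg)
  · exact ⟨hf, hv, h, hσ⟩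
  · exact ⟨hg.1, hg.2.1, hg.2.2.1.trans h, hg.2.2.2⟩

lemma degreeBefore_le_of_imp {d : ℕ} {V : Config d} {σ ρ : Sym2 (Vertex d) → Prop}
    {v : Vertex d} {τ : ℝ}
    (h : ∀ f, IsNNEdge f → v ∈ f → V f < τ → σ f → ρ f) :
    degreeBefore V σ v τ ≤ degreeBefore V ρ v τ :=
  Set.ncard_le_ncard (fun f hf => ⟨hf.1, hf.2.1, hf.2.2.1, h f hf.1 hf.2.1 hf.2.2.1 hf.2.2.2⟩)
    (finite_degreeBefore V ρ v τ)

lemma degreeBefore_le_succ_of_imp {d : ℕ} {V : Config d} {σ ρ : Sym2 (Vertex d) → Prop}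
    {v : Vertex d} {τ : ℝ} {a : Sym2 (Vertex d)}
    (h : ∀ f, IsNNEdge f → v ∈ f → V f < τ → σ f → ρ f ∨ f = a) :
    degreeBefore V σ v τ ≤ degreeBefore V ρ v τ + 1 := by
  refine (Set.ncard_le_ncard (t := insert a {f | IsNNEdge f ∧ v ∈ f ∧ V f < τ ∧ ρ f}) ?_
    ((finite_degreeBefore V ρ v τ).insert a)).trans (Set.ncard_insert_le _ _)
  rintro f ⟨h1, h2, h3, h4⟩
  rcases h f h1 h2 h3 h4 with h | h
  · exact .inr ⟨h1, h2, h3, h⟩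
  · exact .inl h

lemma degreeBefore_le_of_exchange {d : ℕ} {V : Config d} {σ ρ : Sym2 (Vertex d) → Prop}
    {v : Vertex d} {τ : ℝ} {a b : Sym2 (Vertex d)} (hb : IsNNEdge b) (hvb : v ∈ b)
    (hbτ : V b < τ) (hρ : ρ b) (hσ : ¬ σ b)
    (h : ∀ f, IsNNEdge f → v ∈ f → V f < τ → σ f → ρ f ∨ f = a) :
    degreeBefore V σ v τ ≤ degreeBefore V ρ v τ := by
  have h1 := degreeBefore_le_succ_of_imp (ρ := fun f => ρ f ∧ f ≠ b)
    (fun f h1 h2 h3 h4 => (h f h1 h2 h3 h4).imp_left fun h5 => ⟨h5, by rintro rfl; exact hσ h4⟩)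
  refine h1.trans ?_
  unfold degreeBefore
  rw [← Set.ncard_insert_of_notMem (a := b) (fun h => h.2.2.2.2 rfl)
    (finite_degreeBefore V _ v _)]
  refine Set.ncard_le_ncard ?_ (finite_degreeBefore V ρ v τ)
  rintro g (rfl | hg)
  · exact ⟨hb, hvb, hbτ, hρ⟩
  · exact ⟨hg.1, hg.2.1, hg.2.2.1, hg.2.2.2.1⟩

/-- The labellings `σ true` and `σ false` both obey the dynamics of `V` away from `e`, which is
the first edge to ring, and is open for `σ true` only. -/
structure Coupled {d : ℕ} (κ : ℕ) (V : Config d) (e : Sym2 (Vertex d))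
    (σ : Bool → Sym2 (Vertex d) → Prop) : Prop where
  edge : IsNNEdge e
  open_true : σ true e
  closed_false : ¬ σ false e
  first : ∀ f, IsNNEdge f → f ≠ e → V e < V f
  inj : ∀ f g, IsNNEdge f → IsNNEdge g → V f = V g → f = g
  open_iff : ∀ c f, IsNNEdge f → f ≠ e →
    (σ c f ↔ ∀ v ∈ f, degreeBefore V (σ c) v (V f) < κ)

/-- The edges with label at most `p` on which the two labellings disagree. -/
def Discrepant {d : ℕ} (V : Config d) (p : ℝ) (σ : Bool → Sym2 (Vertex d) → Prop)
    (f : Sym2 (Vertex d)) : Prop :=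
  IsNNEdge f ∧ V f ≤ p ∧ ∃ c, σ c f ∧ ¬ σ (!c) f

/-- `f` is one of the first `n + 1` edges of the walk `r`. -/
def OnArm {d : ℕ} (n : ℕ) (r : ℕ → Vertex d) (f : Sym2 (Vertex d)) : Prop :=
  ∃ j ≤ n, f = s(r j, r (j + 1))

/-- The conditions on one of two arms `r` and `l`, both starting with the edge `e` but in
opposite directions, which together form an initial piece of the switching path. -/
structure IsArm {d : ℕ} (V : Config d) (p : ℝ) (e : Sym2 (Vertex d))
    (σ : Bool → Sym2 (Vertex d) → Prop) (A B : ℕ) (l r : ℕ → Vertex d) : Prop where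
  adj : ∀ j ≤ B, adj (r j) (r (j + 1))
  start : r 0 = l 1
  eq_start : e = s(r 0, r 1)
  le : ∀ j ≤ B, V s(r j, r (j + 1)) ≤ p
  sign : ∀ j ≤ B, ∀ c, σ c s(r j, r (j + 1)) ↔ (c = true ↔ Even j)
  lt : ∀ j < B, V s(r j, r (j + 1)) < V s(r (j + 1), r (j + 2))
  later : ∀ f, Discrepant V p σ f → ¬ OnArm A l f → ¬ OnArm B r f →
    V s(r B, r (B + 1)) < V f
  interior : ∀ j, 1 ≤ j → j ≤ B → ∀ f, Discrepant V p σ f → r j ∈ f → OnArm A l f ∨ OnArm B r f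
  injOn : ∀ j k, 1 ≤ j → j ≤ B + 1 → 1 ≤ k → k ≤ B + 1 → r j = r k → j = k

/-- The two arms together form an initial piece of the switching path. -/
structure IsArmPair {d : ℕ} (V : Config d) (p : ℝ) (e : Sym2 (Vertex d))
    (σ : Bool → Sym2 (Vertex d) → Prop) (A B : ℕ) (l r : ℕ → Vertex d) : Prop where
  left : IsArm V p e σ B A r l
  right : IsArm V p e σ A B l r
  disjoint : ∀ j k, 1 ≤ j → j ≤ A + 1 → 1 ≤ k → k ≤ B + 1 → l j = r k → j = A + 1 ∧ k = B + 1

section Arms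

variable {d κ : ℕ} {V : Config d} {p : ℝ} {e : Sym2 (Vertex d)}
  {σ : Bool → Sym2 (Vertex d) → Prop} {A B : ℕ} {l r : ℕ → Vertex d}

lemma IsArmPair.symm (h : IsArmPair V p e σ A B l r) : IsArmPair V p e σ B A r l :=
  ⟨h.right, h.left, fun j k h1 h2 h3 h4 h5 => (h.disjoint k j h3 h4 h1 h2 h5.symm).symm⟩

lemma Coupled.lt_of_mem {f : Sym2 (Vertex d)} (hc : Coupled κ V e σ) (hf : IsNNEdge f)
    (hfe : f ≠ e) {c : Bool} (h : σ c f) {v : Vertex d} (hv : v ∈ f) :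
    degreeBefore V (σ c) v (V f) < κ :=
  (hc.open_iff c f hf hfe).1 h v hv

lemma IsArm.discrepant (h : IsArm V p e σ A B l r) {j : ℕ} (hj : j ≤ B) :
    Discrepant V p σ s(r j, r (j + 1)) := by
  refine ⟨isNNEdge_mk.2 (h.adj j hj), h.le j hj, decide (Even j), ?_, ?_⟩ <;>
    rw [h.sign j hj] <;> by_cases hE : Even j <;> simp [hE]

lemma IsArm.onArm_start (h : IsArm V p e σ A B l r) : OnArm B r e :=
  ⟨0, Nat.zero_le _, h.eq_start⟩

lemma IsArm.even_sum (h : IsArm V p e σ A B l r) {j : ℕ} (hj : j ≤ B + 1) :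
    Even (∑ i, r j i) ↔ (Even (∑ i, r 0 i) ↔ Even j) := by
  induction j with
  | zero => simp
  | succ j ih =>
    rw [even_sum_of_adj (h.adj j (by omega)), ih (by omega), Nat.even_add_one]
    tauto

/-- Where the two arms meet, their last edges have opposite signs. -/
lemma IsArmPair.even_iff_of_eq (h : IsArmPair V p e σ A B l r) (heq : l (A + 1) = r (B + 1)) :
    Even A ↔ ¬ Even B := by
  have h1 := h.left.even_sum le_rfl
  have h2 := h.right.even_sum le_rfl
  have h3 := even_sum_of_adj (h.right.adj 0 (Nat.zero_le _))
  rw [zero_add, ← h.left.start] at h3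
  rw [heq, h2, Nat.even_add_one, Nat.even_add_one] at h1
  tauto

/-- The edges of the arms at the tip of the right arm. -/
lemma IsArmPair.eq_last (h : IsArmPair V p e σ A B l r) {f : Sym2 (Vertex d)}
    (hf : OnArm A l f ∨ OnArm B r f) (hm : r (B + 1) ∈ f) :
    f = s(r B, r (B + 1)) ∨ (f = s(l A, l (A + 1)) ∧ l (A + 1) = r (B + 1)) := by
  rcases hf with ⟨j, hj, rfl⟩ | ⟨j, hj, rfl⟩
  · rcases Sym2.mem_iff.1 hm with h1 | h1
    · rcases Nat.eq_zero_or_pos j with rfl | hj0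
      · rw [h.left.start] at h1
        have := h.right.injOn (B + 1) 1 (by omega) (by omega) (by omega) (by omega) h1
        obtain rfl : B = 0 := by omega
        rw [← h.left.eq_start, ← h.right.eq_start]
        exact .inl rfl
      · have := h.disjoint j (B + 1) (by omega) (by omega) (by omega) (by omega) h1.symm
        omega
    · have := h.disjoint (j + 1) (B + 1) (by omega) (by omega) (by omega) (by omega) h1.symm
      obtain rfl : j = A := by omega
      exact .inr ⟨rfl, h1.symm⟩
  · rcases Sym2.mem_iff.1 hm with h1 | h1
    · rcases Nat.eq_zero_or_pos j with rfl | hj0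
      · rw [h.right.start] at h1
        have := h.disjoint 1 (B + 1) (by omega) (by omega) (by omega) (by omega) h1.symm
        obtain rfl : A = 0 := by omega
        refine .inr ⟨?_, h1.symm⟩
        rw [← h.left.eq_start, ← h.right.eq_start]
      · have := h.right.injOn (B + 1) j (by omega) (by omega) (by omega) (by omega) h1
        omega
    · have := h.right.injOn (B + 1) (j + 1) (by omega) (by omega) (by omega) (by omega) h1
      obtain rfl : j = B := by omega
      exact .inl rfl

/-- A discrepancy other than `e` is blocked in one of the labellings at a vertex where an earlier
discrepancy occurred. -/
lemma Coupled.exists_earlier (hc : Coupled κ V e σ) {g : Sym2 (Vertex d)}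
    (hg : Discrepant V p σ g) (hge : g ≠ e) :
    ∃ c, σ c g ∧ ¬ σ (!c) g ∧ ∃ v ∈ g, κ ≤ degreeBefore V (σ !c) v (V g) ∧
      ∃ f, Discrepant V p σ f ∧ v ∈ f ∧ V f < V g ∧ σ (!c) f ∧ ¬ σ c f := by
  obtain ⟨hgN, hgp, c, h1, h2⟩ := hg
  have h3 := (hc.open_iff _ _ hgN hge).not.1 h2
  push Not at h3
  obtain ⟨v, hv, hκ⟩ := h3
  refine ⟨c, h1, h2, v, hv, hκ, ?_⟩
  by_contra! hno
  have h4 := hc.lt_of_mem hgN hge h1 hv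
  have : degreeBefore V (σ !c) v (V g) ≤ degreeBefore V (σ c) v (V g) :=
    degreeBefore_le_of_imp fun f hf hvf hlt hσ => by
      by_contra hσ'
      exact hσ' (hno f ⟨hf, hlt.le.trans hgp, !c, hσ, by simpa using hσ'⟩ hvf hlt hσ)
  omega

/-- A vertex of the arms incident to a discrepancy off the arms is a tip. -/
lemma IsArmPair.eq_tip (h : IsArmPair V p e σ A B l r) {f g : Sym2 (Vertex d)}
    (hf : OnArm A l f ∨ OnArm B r f) {v : Vertex d} (hvf : v ∈ f) (hg : Discrepant V p σ g)
    (hgl : ¬ OnArm A l g) (hgr : ¬ OnArm B r g) (hvg : v ∈ g) :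
    v = l (A + 1) ∨ v = r (B + 1) := by
  have hl : ∀ j, 1 ≤ j → j ≤ A + 1 → v = l j → v = l (A + 1) := by
    rintro j h1 h2 rfl
    by_cases hj : j = A + 1
    · rw [hj]
    · have := h.left.interior j h1 (by omega) g hg hvg
      tauto
  have hr : ∀ j, 1 ≤ j → j ≤ B + 1 → v = r j → v = r (B + 1) := by
    rintro j h1 h2 rfl
    by_cases hj : j = B + 1
    · rw [hj]
    · have := h.right.interior j h1 (by omega) g hg hvg
      tauto
  rcases hf with ⟨j, hj, rfl⟩ | ⟨j, hj, rfl⟩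
  · rcases Sym2.mem_iff.1 hvf with h1 | h1
    · rcases Nat.eq_zero_or_pos j with rfl | hj0
      · exact .inr (hr 1 le_rfl (by omega) (h1.trans h.left.start))
      · exact .inl (hl j hj0 (by omega) h1)
    · exact .inl (hl (j + 1) (by omega) (by omega) h1)
  · rcases Sym2.mem_iff.1 hvf with h1 | h1
    · rcases Nat.eq_zero_or_pos j with rfl | hj0
      · exact .inl (hl 1 le_rfl (by omega) (h1.trans h.right.start))
      · exact .inr (hr j hj0 (by omega) h1)
    · exact .inr (hr (j + 1) (by omega) (by omega) h1)

/-- If some discrepancy is not on the arms, there is a first one. -/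
lemma IsArmPair.exists_first (hc : Coupled κ V e σ) (hV : NoDescendingWalk V)
    (h : IsArmPair V p e σ A B l r)
    (hex : ∃ f, Discrepant V p σ f ∧ ¬ OnArm A l f ∧ ¬ OnArm B r f) :
    ∃ g, Discrepant V p σ g ∧ ¬ OnArm A l g ∧ ¬ OnArm B r g ∧
      ∀ f, Discrepant V p σ f → ¬ OnArm A l f → ¬ OnArm B r f → V g ≤ V f := by
  let T : Set (Sym2 (Vertex d)) := {f | (Discrepant V p σ f ∧ ¬ OnArm A l f ∧ ¬ OnArm B r f) ∧
    (l (A + 1) ∈ f ∨ r (B + 1) ∈ f)}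
  have hT : T.Finite := ((finite_edges_at (l (A + 1))).union (finite_edges_at (r (B + 1)))).subset
    fun f hf => hf.2.imp (fun h => ⟨hf.1.1.1, h⟩) (fun h => ⟨hf.1.1.1, h⟩)
  have key : ∀ f, Discrepant V p σ f → ¬ OnArm A l f → ¬ OnArm B r f → ∃ g ∈ T, V g ≤ V f := by
    intro f
    induction f using (wellFounded_earlierNeighbour hV).induction with
    | _ f ih =>
      intro hf hl hr
      obtain ⟨c, -, -, v, hv, -, g, hg, hvg, hlt, -⟩ := hc.exists_earlier hf
        (by rintro rfl; exact hl h.left.onArm_start)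
      by_cases hgP : OnArm A l g ∨ OnArm B r g
      · refine ⟨f, ⟨⟨hf, hl, hr⟩, ?_⟩, le_rfl⟩
        rcases h.eq_tip hgP hvg hf hl hr hv with rfl | rfl
        · exact .inl hv
        · exact .inr hv
      · push Not at hgP
        obtain ⟨g', hg', hle⟩ := ih g ⟨hg.1, ⟨v, hvg, hv⟩, hlt⟩ hg hgP.1 hgP.2
        exact ⟨g', hg', hle.trans hlt.le⟩
  obtain ⟨f, hf⟩ := hex
  obtain ⟨f', hf', -⟩ := key f hf.1 hf.2.1 hf.2.2
  obtain ⟨g, hg, hmin⟩ := Set.exists_min_image T V hT ⟨f', hf'⟩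
  refine ⟨g, hg.1.1, hg.1.2.1, hg.1.2.2, fun f h1 h2 h3 => ?_⟩
  obtain ⟨f', hf', hle⟩ := key f h1 h2 h3
  exact (hmin f' hf').trans hle

/-- The walk `r` with all vertices after the `n`-th replaced by `w`. -/
def extendArm (n : ℕ) (r : ℕ → Vertex d) (w : Vertex d) (j : ℕ) : Vertex d :=
  if j ≤ n then r j else w

lemma extendArm_of_le {n j : ℕ} (w : Vertex d) (hj : j ≤ n) : extendArm n r w j = r j :=
  if_pos hj

lemma extendArm_succ (n : ℕ) (w : Vertex d) : extendArm n r w (n + 1) = w :=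
  if_neg (by omega)

lemma onArm_extendArm {w : Vertex d} {f : Sym2 (Vertex d)} :
    OnArm (B + 1) (extendArm (B + 1) r w) f ↔ OnArm B r f ∨ f = s(r (B + 1), w) := by
  constructor
  · rintro ⟨j, hj, rfl⟩
    rcases Nat.lt_or_ge B j with h | h
    · obtain rfl : j = B + 1 := by omega
      rw [extendArm_succ, extendArm_of_le w le_rfl]
      exact .inr rfl
    · rw [extendArm_of_le w hj, extendArm_of_le w (by omega)]
      exact .inl ⟨j, h, rfl⟩
  · rintro (⟨j, hj, rfl⟩ | rfl)
    · exact ⟨j, by omega, by rw [extendArm_of_le w (by omega), extendArm_of_le w (by omega)]⟩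
    · exact ⟨B + 1, le_rfl, by rw [extendArm_succ, extendArm_of_le w le_rfl]⟩

/-- If the first discrepancy off the arms is blocked at the tip of the right arm, then the arms
do not meet there. -/
lemma IsArmPair.tip_ne (h : IsArmPair V p e σ A B l r) {g f : Sym2 (Vertex d)}
    (hgl : ¬ OnArm A l g) (hgr : ¬ OnArm B r g) (hg : Discrepant V p σ g)
    (hmin : ∀ f, Discrepant V p σ f → V f < V g → OnArm A l f ∨ OnArm B r f) {c : Bool}
    (hdeg : degreeBefore V (σ c) (r (B + 1)) (V g) < degreeBefore V (σ !c) (r (B + 1)) (V g))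
    (hf : Discrepant V p σ f) (hvf : r (B + 1) ∈ f) (hfg : V f < V g) (hfo : σ (!c) f) :
    l (A + 1) ≠ r (B + 1) := by
  intro heq
  have hL := h.left.discrepant le_rfl
  have hR := h.right.discrepant le_rfl
  have hsL := h.left.sign A le_rfl
  have hsR := h.right.sign B le_rfl
  have hAB := h.even_iff_of_eq heq
  have hlast : ∀ f', Discrepant V p σ f' → r (B + 1) ∈ f' → V f' < V g →
      f' = s(r B, r (B + 1)) ∨ f' = s(l A, l (A + 1)) := fun f' h1 h2 h3 =>
    (h.eq_last (hmin f' h1 h3) h2).imp_right And.left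
  have hdisc : ∀ f', IsNNEdge f' → V f' < V g → σ (!c) f' → ¬ σ c f' → Discrepant V p σ f' :=
    fun f' h1 h2 h3 h4 => ⟨h1, h2.le.trans hg.2.1, !c, h3, by simpa using h4⟩
  obtain ⟨b, hbN, hvb, hbg, hb1, hb2, hfb⟩ : ∃ b, IsNNEdge b ∧ r (B + 1) ∈ b ∧ V b < V g ∧
      σ c b ∧ ¬ σ (!c) b ∧ ∀ f', (f' = s(r B, r (B + 1)) ∨ f' = s(l A, l (A + 1))) →
        f' = f ∨ f' = b := by
    rcases hlast f hf hvf hfg with rfl | rfl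
    · refine ⟨s(l A, l (A + 1)), hL.1, by simp [heq], h.left.later g hg hgr hgl, ?_, ?_,
        fun _ => id⟩
      all_goals
        rw [hsR] at hfo
        rw [hsL, hAB]
        generalize Even B = E at hfo
        by_cases hE : E <;> cases c <;> simp [hE] at hfo ⊢
    · refine ⟨s(r B, r (B + 1)), hR.1, by simp, h.right.later g hg hgl hgr, ?_, ?_,
        fun _ => Or.symm⟩
      all_goals
        rw [hsL, hAB] at hfo
        rw [hsR]
        generalize Even B = E at hfo
        by_cases hE : E <;> cases c <;> simp [hE] at hfo ⊢
  refine absurd hdeg (not_lt.2 (degreeBefore_le_of_exchange (a := f) hbN hvb hbg hb1 hb2 ?_))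
  intro f' h1 h2 h3 h4
  by_contra! hno
  rcases hfb f' (hlast f' (hdisc f' h1 h3 h4 hno.1) h2 h3) with rfl | rfl
  · exact hno.2 rfl
  · exact hb2 h4

/-- The first discrepancy off the arms prolongs the right arm if it is blocked at its tip. -/
lemma IsArmPair.extend (hc : Coupled κ V e σ) (h : IsArmPair V p e σ A B l r)
    {g f : Sym2 (Vertex d)} (hg : Discrepant V p σ g)
    (hgl : ¬ OnArm A l g) (hgr : ¬ OnArm B r g)
    (hmin : ∀ f, Discrepant V p σ f → ¬ OnArm A l f → ¬ OnArm B r f → V g ≤ V f) {c : Bool}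
    (hgo : σ c g) (hgc : ¬ σ (!c) g) (hvg : r (B + 1) ∈ g)
    (hκ : κ ≤ degreeBefore V (σ !c) (r (B + 1)) (V g))
    (hf : Discrepant V p σ f) (hvf : r (B + 1) ∈ f) (hfg : V f < V g) (hfo : σ (!c) f) :
    ∃ w, adj (r (B + 1)) w ∧ V s(r B, r (B + 1)) < V s(r (B + 1), w) ∧
      IsArmPair V p e σ A (B + 1) l (extendArm (B + 1) r w) := by
  have hmin' : ∀ f, Discrepant V p σ f → V f < V g → OnArm A l f ∨ OnArm B r f := by
    intro f h1 h2
    by_contra! h3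
    exact absurd (hmin f h1 h3.1 h3.2) (not_le.2 h2)
  have hge : g ≠ e := by rintro rfl; exact hgr h.right.onArm_start
  have hlt := hc.lt_of_mem hg.1 hge hgo hvg
  have hne := h.tip_ne hgl hgr hg hmin' (hlt.trans_le hκ) hf hvf hfg hfo
  have hlast : ∀ f', Discrepant V p σ f' → r (B + 1) ∈ f' → V f' < V g →
      f' = s(r B, r (B + 1)) := fun f' h1 h2 h3 =>
    (h.eq_last (hmin' f' h1 h3) h2).resolve_right fun h4 => hne h4.2
  obtain rfl := hlast f hf hvf hfg
  -- the tip is saturated in both labellings once `g` has rung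
  have hsat : ∀ c', ∀ τ, V g < τ → κ ≤ degreeBefore V (σ c') (r (B + 1)) τ := by
    intro c' τ hτ
    have h1 : degreeBefore V (σ !c) (r (B + 1)) (V g) ≤
        degreeBefore V (σ c) (r (B + 1)) (V g) + 1 := by
      refine degreeBefore_le_succ_of_imp (a := s(r B, r (B + 1))) fun f' h1 h2 h3 h4 => ?_
      by_contra! hno
      exact hno.2 (hlast f' ⟨h1, h3.le.trans hg.2.1, !c, h4, by simpa using hno.1⟩ h2 h3)
    have h2 := degreeBefore_succ_le hg.1 hvg hgo hτ
    have h3 := degreeBefore_mono V (σ !c) (r (B + 1)) hτ.le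
    rcases Bool.eq_or_eq_not c' c with rfl | rfl <;> omega
  have hclosed : ∀ f', Discrepant V p σ f' → r (B + 1) ∈ f' →
      OnArm A l f' ∨ OnArm B r f' ∨ f' = g := by
    intro f' h1 h2
    by_contra! hno
    have h3 : V g < V f' := lt_of_le_of_ne (hmin f' h1 hno.1 hno.2.1)
      fun h4 => hno.2.2 (hc.inj g f' hg.1 h1.1 h4).symm
    obtain ⟨hN, -, c', h4, -⟩ := h1
    have := hc.lt_of_mem hN (by rintro rfl; exact hno.2.1 h.right.onArm_start) h4 h2
    have := hsat c' _ h3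
    omega
  have hBg := h.right.later g hg hgl hgr
  obtain ⟨w, hw, rfl⟩ := hg.1.exists_eq_mk hvg
  have hsign : ∀ c', σ c' s(r (B + 1), w) ↔ (c' = true ↔ Even (B + 1)) := by
    intro c'
    rw [h.right.sign B le_rfl] at hfo
    rw [Nat.even_add_one]
    rcases Bool.eq_or_eq_not c' c with rfl | rfl
    · cases c' <;> simp_all
    · cases c <;> simp_all
  have hwl : ∀ j, 1 ≤ j → j ≤ A → l j ≠ w := by
    rintro j h1 h2 rfl
    exact (h.left.interior j h1 h2 _ hg (by simp)).elim hgr hgl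
  have hwr : ∀ j, 1 ≤ j → j ≤ B + 1 → r j ≠ w := by
    rintro j h1 h2 rfl
    rcases h2.eq_or_lt with rfl | h2
    · exact not_adj_self _ hw
    · exact (h.right.interior j h1 (by omega) _ hg (by simp)).elim hgl hgr
  have hP : ∀ f, ¬ OnArm (B + 1) (extendArm (B + 1) r w) f →
      ¬ OnArm B r f ∧ f ≠ s(r (B + 1), w) := fun f hf =>
    not_or.1 (onArm_extendArm.not.1 hf)
  refine ⟨w, hw, hBg, ⟨?_, ?_, ?_⟩⟩
  · exact
      { adj := h.left.adj
        start := by rw [extendArm_of_le w (by omega), h.left.start]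
        eq_start := h.left.eq_start
        le := h.left.le
        sign := h.left.sign
        lt := h.left.lt
        later := fun f h1 h2 h3 => h.left.later f h1 (hP f h2).1 h3
        interior := fun j h1 h2 f h3 h4 => (h.left.interior j h1 h2 f h3 h4).imp_left
          fun h5 => onArm_extendArm.2 (.inl h5)
        injOn := h.left.injOn }
  · have hcase : ∀ j ≤ B + 1, j = B + 1 ∨ j ≤ B := fun j hj => by omega
    refine
      { adj := fun j hj => ?_
        start := by rw [extendArm_of_le w (by omega), h.right.start]
        eq_start := by
          rw [extendArm_of_le w (by omega), extendArm_of_le w (by omega), h.right.eq_start]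
        le := fun j hj => ?_
        sign := fun j hj => ?_
        lt := fun j hj => ?_
        later := fun f h1 h2 h3 => ?_
        interior := fun j h1 h2 f h3 h4 => ?_
        injOn := fun j k h1 h2 h3 h4 h5 => ?_ }
    · rcases hcase j hj with rfl | hj
      · rwa [extendArm_succ, extendArm_of_le w le_rfl]
      · rw [extendArm_of_le w (by omega), extendArm_of_le w (by omega)]
        exact h.right.adj j hj
    · rcases hcase j hj with rfl | hj
      · rw [extendArm_succ, extendArm_of_le w le_rfl]
        exact hg.2.1
      · rw [extendArm_of_le w (by omega), extendArm_of_le w (by omega)]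
        exact h.right.le j hj
    · rcases hcase j hj with rfl | hj
      · rwa [extendArm_succ, extendArm_of_le w le_rfl]
      · rw [extendArm_of_le w (by omega), extendArm_of_le w (by omega)]
        exact h.right.sign j hj
    · rw [extendArm_of_le w (by omega), extendArm_of_le w (by omega)]
      rcases hcase (j + 1) hj with hj | hj
      · obtain rfl : j = B := by omega
        rwa [extendArm_succ]
      · rw [extendArm_of_le w (by omega)]
        exact h.right.lt j (by omega)
    · rw [extendArm_succ, extendArm_of_le w le_rfl]
      exact lt_of_le_of_ne (hmin f h1 h2 (hP f h3).1)
        fun h4 => (hP f h3).2 (hc.inj _ _ hg.1 h1.1 h4).symm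
    · rw [extendArm_of_le w (by omega)] at h4
      rw [onArm_extendArm]
      rcases hcase j h2 with rfl | h2
      · exact hclosed f h3 h4
      · have := h.right.interior j h1 h2 f h3 h4
        tauto
    · rcases h2.eq_or_lt with rfl | h2 <;> rcases h4.eq_or_lt with rfl | h4
      · rfl
      · rw [extendArm_succ, extendArm_of_le w (by omega)] at h5
        exact absurd h5.symm (hwr k h3 (by omega))
      · rw [extendArm_succ, extendArm_of_le w (by omega)] at h5
        exact absurd h5 (hwr j h1 (by omega))
      · rw [extendArm_of_le w (by omega), extendArm_of_le w (by omega)] at h5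
        exact h.right.injOn j k h1 (by omega) h3 (by omega) h5
  · intro j k h1 h2 h3 h4 h5
    rcases h4.eq_or_lt with rfl | h4
    · rw [extendArm_succ] at h5
      refine ⟨?_, rfl⟩
      by_contra hj
      exact hwl j h1 (by omega) h5
    · rw [extendArm_of_le w (by omega)] at h5
      obtain ⟨rfl, rfl⟩ := h.disjoint j k h1 h2 h3 (by omega) h5
      exact absurd h5 hne

/-- The arms can be prolonged until they exhaust all discrepancies. -/
lemma IsArmPair.exists_complete (hc : Coupled κ V e σ) (hV : NoDescendingWalk V)
    (hV' : NoDescendingWalk (-V)) (h : IsArmPair V p e σ A B l r) :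
    ∃ A B l r, IsArmPair V p e σ A B l r ∧
      ∀ f, Discrepant V p σ f → OnArm A l f ∨ OnArm B r f := by
  generalize hx : (l A, l (A + 1)) = x
  generalize hy : (r B, r (B + 1)) = y
  induction x, y using Prod.GameAdd.recursion (wellFounded_continues hV')
    (wellFounded_continues hV') generalizing A B l r with
  | _ x y ih =>
    subst hx hy
    by_cases hex : ∃ f, Discrepant V p σ f ∧ ¬ OnArm A l f ∧ ¬ OnArm B r f
    · obtain ⟨g, hg, hgl, hgr, hmin⟩ := h.exists_first hc hV hex
      obtain ⟨c, hgo, hgc, v, hv, hκ, f, hf, hvf, hlt, hfo, -⟩ := hc.exists_earlier hg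
        (by rintro rfl; exact hgl h.left.onArm_start)
      have hfP : OnArm A l f ∨ OnArm B r f := by
        by_contra! hno
        exact absurd (hmin f hf hno.1 hno.2) (not_le.2 hlt)
      rcases h.eq_tip hfP hvf hg hgl hgr hv with rfl | rfl
      · obtain ⟨w, hw, hVw, h'⟩ := h.symm.extend hc hg hgr hgl
          (fun f h1 h2 h3 => hmin f h1 h3 h2) hgo hgc hv hκ hf hvf hlt hfo
        refine ih _ _ ?_ h'.symm rfl rfl
        rw [extendArm_succ, extendArm_of_le w le_rfl]
        exact .fst ⟨rfl, hw, neg_lt_neg hVw⟩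
      · obtain ⟨w, hw, hVw, h'⟩ := h.extend hc hg hgl hgr hmin hgo hgc hv hκ hf hvf hlt hfo
        refine ih _ _ ?_ h' rfl rfl
        rw [extendArm_succ, extendArm_of_le w le_rfl]
        exact .snd ⟨rfl, hw, neg_lt_neg hVw⟩
    · push Not at hex
      refine ⟨A, B, l, r, h, fun f hf => ?_⟩
      have := hex f hf
      tauto

/-- The two arms consisting of the single edge `e`. -/
lemma Coupled.isArmPair_start (hc : Coupled κ V e σ) (hp : V e ≤ p) {x y : Vertex d}
    (he : e = s(x, y)) :
    IsArmPair V p e σ 0 0 (fun j => if j = 0 then y else x) (fun j => if j = 0 then x else y) := by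
  have key : ∀ x y : Vertex d, e = s(x, y) →
      IsArm V p e σ 0 0 (fun j => if j = 0 then y else x) (fun j => if j = 0 then x else y) := by
    rintro x y rfl
    have hadj := isNNEdge_mk.1 hc.edge
    refine
      { adj := fun j hj => ?_
        start := by simp
        eq_start := by simp
        le := fun j hj => ?_
        sign := fun j hj c => ?_
        lt := fun j hj => by omega
        later := fun f h1 _ h3 => ?_
        interior := fun j h1 h2 => by omega
        injOn := fun j k h1 h2 h3 h4 _ => by omega }
    · obtain rfl : j = 0 := by omega
      simpa using hadj
    · obtain rfl : j = 0 := by omega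
      simpa using hp
    · obtain rfl : j = 0 := by omega
      have h1 := hc.open_true
      have h2 := hc.closed_false
      cases c <;> simp [h1, h2]
    · refine hc.first f h1.1 ?_
      rintro rfl
      exact h3 ⟨0, le_rfl, by simp⟩
  refine ⟨key y x (he.trans Sym2.eq_swap), key x y he, ?_⟩
  intro j k h1 h2 h3 h4 _
  omega

/-- The walk that runs along `l` from its `(A + 1)`-st vertex back to its first one, and then along
`r` from its first vertex on. -/
def joinArms (A : ℕ) (l r : ℕ → Vertex d) (j : ℕ) : Vertex d :=
  if j ≤ A then l (A + 1 - j) else r (j - A)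

lemma joinArms_left {j k : ℕ} (hk : 1 ≤ k) (h : j + k = A + 1) : joinArms A l r j = l k := by
  rw [joinArms, if_pos (by omega)]
  congr
  omega

lemma joinArms_right {j k : ℕ} (hk : 1 ≤ k) (h : j = A + k) : joinArms A l r j = r k := by
  rw [joinArms, if_neg (by omega)]
  congr
  omega

/-- An edge of the joined walk before `e`. -/
lemma IsArmPair.join_edge_left (h : IsArmPair V p e σ A B l r) {j k : ℕ} (hjk : j + k = A) :
    s(joinArms A l r j, joinArms A l r (j + 1)) = s(l k, l (k + 1)) := by
  rw [joinArms_left (k := k + 1) (by omega) (by omega)]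
  rcases Nat.eq_zero_or_pos k with rfl | hk
  · rw [joinArms_right (k := 1) le_rfl (by omega), ← h.left.start, Sym2.eq_swap]
  · rw [joinArms_left (k := k) hk (by omega), Sym2.eq_swap]

/-- An edge of the joined walk after `e`. -/
lemma IsArmPair.join_edge_right (h : IsArmPair V p e σ A B l r) {j k : ℕ} (hjk : j = A + k) :
    s(joinArms A l r j, joinArms A l r (j + 1)) = s(r k, r (k + 1)) := by
  rcases Nat.eq_zero_or_pos k with rfl | hk
  · rw [h.join_edge_left (k := 0) (by omega), ← h.left.eq_start, ← h.right.eq_start]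
  · rw [joinArms_right hk hjk, joinArms_right (k := k + 1) (by omega) (by omega)]

lemma IsArm.strictMono_label (h : IsArm V p e σ A B l r) {j k : ℕ} (hjk : j < k) (hk : k ≤ B) :
    V s(r j, r (j + 1)) < V s(r k, r (k + 1)) := by
  induction k, hjk using Nat.le_induction with
  | base => exact h.lt j (by omega)
  | succ k hjk ih => exact (ih (by omega)).trans (h.lt k (by omega))

lemma IsArm.eq_of_edge_eq (h : IsArm V p e σ A B l r) {j k : ℕ} (hj : j ≤ B) (hk : k ≤ B)
    (heq : s(r j, r (j + 1)) = s(r k, r (k + 1))) : j = k := by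
  rcases lt_trichotomy j k with hlt | rfl | hlt
  · exact absurd (congrArg V heq) (h.strictMono_label hlt hk).ne
  · rfl
  · exact absurd (congrArg V heq) (h.strictMono_label hlt hj).ne'

/-- The two arms share no edge but `e`. -/
lemma IsArmPair.edge_ne (h : IsArmPair V p e σ A B l r) {j k : ℕ} (hj : 1 ≤ j) (hjA : j ≤ A)
    (hk : k ≤ B) : s(l j, l (j + 1)) ≠ s(r k, r (k + 1)) := by
  intro heq
  rcases Nat.eq_zero_or_pos k with rfl | hk0
  · rw [zero_add, ← h.right.eq_start, h.left.eq_start] at heq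
    have := h.left.eq_of_edge_eq (j := j) (k := 0) hjA (Nat.zero_le _) heq
    omega
  · have hm : l j ∈ s(r k, r (k + 1)) := heq ▸ Sym2.mem_mk_left _ _
    rcases Sym2.mem_iff.1 hm with h1 | h1
    · have := h.disjoint j k hj (by omega) hk0 (by omega) h1
      omega
    · have := h.disjoint j (k + 1) hj (by omega) (by omega) (by omega) h1
      omega

/-- The joined walk satisfies all requirements on the switching path. -/
lemma IsArmPair.exists_path (h : IsArmPair V p e σ A B l r)
    (hall : ∀ f, Discrepant V p σ f → OnArm A l f ∨ OnArm B r f) :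
    ∃ (m i : ℕ) (x : ℕ → Vertex d), 0 < m ∧ i < m ∧
      (∀ j < m, CDP.adj (x j) (x (j + 1))) ∧
      e = s(x i, x (i + 1)) ∧
      (∀ j ≤ m, ∀ j' ≤ m, x j = x j' → j = j' ∨ (j = 0 ∧ j' = m) ∨ (j = m ∧ j' = 0)) ∧
      (∀ j < m, ∀ j' < m, s(x j, x (j + 1)) = s(x j', x (j' + 1)) → j = j') ∧
      {f | Discrepant V p σ f} = {f | ∃ j < m, f = s(x j, x (j + 1))} ∧
      (∀ j < i, V s(x j, x (j + 1)) ≤ p) ∧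
      (∀ j, j + 1 < i → V s(x (j + 1), x (j + 2)) < V s(x j, x (j + 1))) ∧
      (∀ j, i < j → j < m → V s(x j, x (j + 1)) ≤ p) ∧
      (∀ j, i + 1 ≤ j → j + 1 < m → V s(x j, x (j + 1)) < V s(x (j + 1), x (j + 2))) := by
  have hvert : ∀ j ≤ A + B + 1, (∃ k, 1 ≤ k ∧ j + k = A + 1) ∨ ∃ k, 1 ≤ k ∧ j = A + k := by
    intro j _
    by_cases hj : j ≤ A
    · exact .inl ⟨A + 1 - j, by omega, by omega⟩
    · exact .inr ⟨j - A, by omega, by omega⟩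
  have hedge : ∀ j < A + B + 1, (∃ k, 1 ≤ k ∧ j + k = A) ∨ ∃ k, j = A + k := by
    intro j _
    by_cases hj : j < A
    · exact .inl ⟨A - j, by omega, by omega⟩
    · exact .inr ⟨j - A, by omega⟩
  refine ⟨A + B + 1, A, joinArms A l r, by omega, by omega, ?_, ?_, ?_, ?_, ?_, ?_, ?_, ?_, ?_⟩
  · intro j hj
    rw [← isNNEdge_mk]
    rcases hedge j hj with ⟨k, hk, hjk⟩ | ⟨k, hjk⟩
    · rw [h.join_edge_left hjk, isNNEdge_mk]
      exact h.left.adj k (by omega)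
    · rw [h.join_edge_right hjk, isNNEdge_mk]
      exact h.right.adj k (by omega)
  · rw [h.join_edge_right (k := 0) (add_zero A).symm]
    exact h.right.eq_start
  · intro j hj j' hj' heq
    rcases hvert j hj with ⟨k, hk, hjk⟩ | ⟨k, hk, hjk⟩ <;>
    rcases hvert j' hj' with ⟨k', hk', hjk'⟩ | ⟨k', hk', hjk'⟩
    · rw [joinArms_left hk hjk, joinArms_left hk' hjk'] at heq
      have := h.left.injOn k k' hk (by omega) hk' (by omega) heq
      omega
    · rw [joinArms_left hk hjk, joinArms_right hk' hjk'] at heq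
      have := h.disjoint k k' hk (by omega) hk' (by omega) heq
      omega
    · rw [joinArms_right hk hjk, joinArms_left hk' hjk'] at heq
      have := h.disjoint k' k hk' (by omega) hk (by omega) heq.symm
      omega
    · rw [joinArms_right hk hjk, joinArms_right hk' hjk'] at heq
      have := h.right.injOn k k' hk (by omega) hk' (by omega) heq
      omega
  · intro j hj j' hj' heq
    rcases hedge j hj with ⟨k, hk, hjk⟩ | ⟨k, hjk⟩ <;>
    rcases hedge j' hj' with ⟨k', hk', hjk'⟩ | ⟨k', hjk'⟩
    · rw [h.join_edge_left hjk, h.join_edge_left hjk'] at heq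
      have := h.left.eq_of_edge_eq (by omega) (by omega) heq
      omega
    · rw [h.join_edge_left hjk, h.join_edge_right hjk'] at heq
      exact absurd heq (h.edge_ne hk (by omega) (by omega))
    · rw [h.join_edge_right hjk, h.join_edge_left hjk'] at heq
      exact absurd heq.symm (h.edge_ne hk' (by omega) (by omega))
    · rw [h.join_edge_right hjk, h.join_edge_right hjk'] at heq
      have := h.right.eq_of_edge_eq (by omega) (by omega) heq
      omega
  · ext f
    constructor
    · intro hf
      rcases hall f hf with ⟨k, hk, rfl⟩ | ⟨k, hk, rfl⟩
      · exact ⟨A - k, by omega, by rw [h.join_edge_left (k := k) (by omega)]⟩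
      · exact ⟨A + k, by omega, by rw [h.join_edge_right rfl]⟩
    · rintro ⟨j, hj, rfl⟩
      rcases hedge j hj with ⟨k, hk, hjk⟩ | ⟨k, hjk⟩
      · rw [h.join_edge_left hjk]
        exact h.left.discrepant (by omega)
      · rw [h.join_edge_right hjk]
        exact h.right.discrepant (by omega)
  · intro j hj
    rw [h.join_edge_left (k := A - j) (by omega)]
    exact h.left.le _ (by omega)
  · intro j hj
    rw [h.join_edge_left (j := j) (k := A - j) (by omega),
      h.join_edge_left (j := j + 1) (k := A - (j + 1)) (by omega)]
    exact h.left.strictMono_label (by omega) (by omega)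
  · intro j hj hjm
    rw [h.join_edge_right (k := j - A) (by omega)]
    exact h.right.le _ (by omega)
  · intro j hj hjm
    rw [h.join_edge_right (j := j) (k := j - A) (by omega),
      h.join_edge_right (j := j + 1) (k := j + 1 - A) (by omega)]
    exact h.right.strictMono_label (by omega) (by omega)

lemma Consistent.iff_degreeBefore {σ : Sym2 (Vertex d) → Prop} (h : Consistent κ V σ)
    {f : Sym2 (Vertex d)} (hf : IsNNEdge f) :
    σ f ↔ ∀ v ∈ f, degreeBefore V σ v (V f) < κ := by
  rw [h f hf]
  refine forall₂_congr fun v _ => ?_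
  have : {g | IsNNEdge g ∧ v ∈ g ∧ g ≠ f ∧ V g < V f ∧ σ g} =
      {g | IsNNEdge g ∧ v ∈ g ∧ V g < V f ∧ σ g} := by
    ext g
    exact ⟨fun ⟨h1, h2, _, h4⟩ => ⟨h1, h2, h4⟩,
      fun ⟨h1, h2, h4⟩ => ⟨h1, h2, by rintro rfl; exact lt_irrefl _ h4.1, h4⟩⟩
  rw [degreeBefore, this]

lemma consistent_of_iff_degreeBefore {σ : Sym2 (Vertex d) → Prop}
    (h : ∀ f, IsNNEdge f → (σ f ↔ ∀ v ∈ f, degreeBefore V σ v (V f) < κ)) :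
    Consistent κ V σ := by
  intro f hf
  rw [h f hf]
  refine forall₂_congr fun v _ => ?_
  have : {g | IsNNEdge g ∧ v ∈ g ∧ g ≠ f ∧ V g < V f ∧ σ g} =
      {g | IsNNEdge g ∧ v ∈ g ∧ V g < V f ∧ σ g} := by
    ext g
    exact ⟨fun ⟨h1, h2, _, h4⟩ => ⟨h1, h2, h4⟩,
      fun ⟨h1, h2, h4⟩ => ⟨h1, h2, by rintro rfl; exact lt_irrefl _ h4.1, h4⟩⟩
  rw [degreeBefore, this]

lemma degreeBefore_congr {V W : Config d} {σ ρ : Sym2 (Vertex d) → Prop} {v : Vertex d}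
    {τ τ' : ℝ} (h : ∀ f, IsNNEdge f → v ∈ f → (V f < τ ∧ σ f ↔ W f < τ' ∧ ρ f)) :
    degreeBefore V σ v τ = degreeBefore W ρ v τ' := by
  unfold degreeBefore
  congr 1
  ext f
  exact and_congr_right fun h1 => and_congr_right fun h2 => h f h1 h2

/-- An edge that opens at its own time can be opened at time `0` instead. -/
lemma Consistent.update_zero {U : Config d} {ρ : Sym2 (Vertex d) → Prop} (hκ : 0 < κ)
    (hpos : ∀ f, IsNNEdge f → 0 < U f)
    (hne : ∀ f, IsNNEdge f → f ≠ e → U f ≠ U e) (hρ : Consistent κ U ρ) (he : IsNNEdge e) (hρe : ρ e) :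
    Consistent κ (Function.update U e 0) ρ := by
  refine consistent_of_iff_degreeBefore fun f hf => ?_
  by_cases hfe : f = e
  · subst hfe
    refine iff_of_true hρe fun v _ => ?_
    have : degreeBefore (Function.update U f 0) ρ v (Function.update U f 0 f) = 0 := by
      unfold degreeBefore
      convert Set.ncard_empty (Sym2 (Vertex d))
      ext g
      simp only [Function.update_self, Set.mem_ofPred_eq, Set.mem_empty_iff_false, iff_false]
      rintro ⟨h1, -, h3, -⟩
      by_cases hgf : g = f
      · subst hgf
        simp at h3
      · rw [Function.update_of_ne hgf] at h3
        exact absurd (hpos g h1) h3.not_gt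
    omega
  rw [Function.update_of_ne hfe]
  have hle : ∀ v, degreeBefore U ρ v (U f) ≤ degreeBefore (Function.update U e 0) ρ v (U f) := by
    intro v
    refine Set.ncard_le_ncard ?_ (finite_degreeBefore _ _ _ _)
    rintro g ⟨h1, h2, h3, h4⟩
    refine ⟨h1, h2, ?_, h4⟩
    by_cases hge : g = e
    · subst hge
      simpa using hpos f hf
    · rwa [Function.update_of_ne hge]
  constructor
  · intro hρf v hv
    by_cases hve : v ∈ e ∧ U f < U e
    · have h1 := (hρ.iff_degreeBefore he).1 hρe v hve.1
      have h2 := degreeBefore_succ_le hf hv hρf hve.2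
      have h3 : degreeBefore (Function.update U e 0) ρ v (U f) ≤
          degreeBefore U ρ v (U f) + 1 := by
        refine (Set.ncard_le_ncard (t := insert e {g | IsNNEdge g ∧ v ∈ g ∧ U g < U f ∧ ρ g}) ?_
          ((finite_degreeBefore U ρ v _).insert e)).trans (Set.ncard_insert_le _ _)
        rintro g ⟨h1, h2, h3, h4⟩
        by_cases hge : g = e
        · exact .inl hge
        · rw [Function.update_of_ne hge] at h3
          exact .inr ⟨h1, h2, h3, h4⟩
      omega
    · convert (hρ.iff_degreeBefore hf).1 hρf v hv using 1
      refine degreeBefore_congr fun g hg hvg => ?_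
      by_cases hge : g = e
      · subst hge
        have hlt : U g < U f :=
          lt_of_le_of_ne (not_lt.1 fun h => hve ⟨hvg, h⟩) (hne f hf hfe).symm
        simp [hlt, hpos f hf]
      · rw [Function.update_of_ne hge]
  · exact fun h => (hρ.iff_degreeBefore hf).2 fun v hv => (hle v).trans_lt (h v hv)


/-- An edge that never opens can ring last instead. -/
lemma Consistent.exists_update_one {U : Config d} {ρ : Sym2 (Vertex d) → Prop}
    (hlt : ∀ f, IsNNEdge f → U f < 1) (hρ : Consistent κ U ρ) (hρe : ¬ ρ e) :
    ∃ ρ', Consistent κ (Function.update U e 1) ρ' ∧ ∀ f ≠ e, (ρ' f ↔ ρ f) := by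
  classical
  let ρ' : Sym2 (Vertex d) → Prop := fun f =>
    if f = e then ∀ v ∈ e, degreeBefore (Function.update U e 1) ρ v 1 < κ else ρ f
  have hρ' : ∀ f ≠ e, (ρ' f ↔ ρ f) := fun f hf => by simp only [ρ', if_neg hf]
  refine ⟨ρ', consistent_of_iff_degreeBefore fun f hf => ?_, hρ'⟩
  by_cases hfe : f = e
  · subst hfe
    simp only [ρ', if_pos, Function.update_self]
    refine forall₂_congr fun v _ => ?_
    rw [degreeBefore_congr fun g _ _ => ?_]
    by_cases hgf : g = f
    · subst hgf
      simp
    · simp [hgf]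
  · rw [hρ' f hfe, hρ.iff_degreeBefore hf, Function.update_of_ne hfe]
    refine forall₂_congr fun v _ => ?_
    rw [degreeBefore_congr fun g _ _ => ?_]
    by_cases hge : g = e
    · subst hge
      simp [hρe, (hlt f hf).le]
    · rw [hρ' g hge, Function.update_of_ne hge]

/-- Opening `e` at time `0` or at time `1` gives a pair of coupled labellings. -/
lemma coupled_update {U : Config d} (hκ : 0 < κ) (hU01 : ∀ f, IsNNEdge f → U f ∈ Set.Ioo (0 : ℝ) 1)
    (hinj : ∀ f g, IsNNEdge f → IsNNEdge g → U f = U g → f = g) (he : IsNNEdge e)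
    {s t : Sym2 (Vertex d) → Prop} (hs : Consistent κ (Function.update U e 0) s)
    (ht : Consistent κ (Function.update U e 1) t) :
    Coupled κ (Function.update U e 0) e (fun c => if c then s else fun f => f ≠ e ∧ t f) := by
  have hfirst : ∀ f, IsNNEdge f → f ≠ e → Function.update U e 0 e < Function.update U e 0 f := by
    intro f hf hfe
    rw [Function.update_self, Function.update_of_ne hfe]
    exact (hU01 f hf).1
  refine
    { edge := he
      open_true := ?_
      closed_false := by simp
      first := hfirst
      inj := fun f g hf hg h => ?_
      open_iff := fun c f hf hfe => ?_ }
  · simp only [if_true]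
    refine (hs.iff_degreeBefore he).2 fun v _ => ?_
    have : degreeBefore (Function.update U e 0) s v (Function.update U e 0 e) = 0 := by
      unfold degreeBefore
      convert Set.ncard_empty (Sym2 (Vertex d))
      ext g
      simp only [Set.mem_ofPred_eq, Set.mem_empty_iff_false, iff_false]
      rintro ⟨h1, -, h3, -⟩
      by_cases hge : g = e
      · subst hge
        exact lt_irrefl _ h3
      · exact (hfirst g h1 hge).not_gt h3
    omega
  · by_cases hfe : f = e <;> by_cases hge : g = e
    · rw [hfe, hge]
    · subst hfe
      exact absurd h (hfirst g hg hge).ne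
    · subst hge
      exact absurd h (hfirst f hf hfe).ne'
    · rw [Function.update_of_ne hfe, Function.update_of_ne hge] at h
      exact hinj f g hf hg h
  · cases c
    · simp only [Bool.false_eq_true, if_false, hfe, ne_eq, not_false_iff, true_and]
      rw [ht.iff_degreeBefore hf, Function.update_of_ne hfe, Function.update_of_ne hfe]
      refine forall₂_congr fun v _ => ?_
      rw [degreeBefore_congr fun g _ _ => ?_]
      by_cases hge : g = e
      · subst hge
        simp [(hU01 f hf).2.le]
      · simp [hge]
    · simpa only [if_true] using hs.iff_degreeBefore hf

end Arms

/-- **Switching path lemma**: `ω_p(U) ∈ {ω_p(U^{e+}), ω_p(U^{e−})}`, the set of edges where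
`ω_p(U^{e+})` and `ω_p(U^{e−})` differ is the edge set of a path containing `e` with possibly
coinciding endpoints but no other self-intersections, and the two halves of this path on
either side of `e` are decreasing. -/
theorem switching_path (d κ : ℕ) (hd : 2 ≤ d) (hκ₁ : 2 ≤ κ) (hκ₂ : κ ≤ 2 * d)
    (U : Config d) (hU : U ∈ goodConfigs d)
    (hU01 : ∀ f, IsNNEdge f → U f ∈ Set.Ioo (0 : ℝ) 1)
    (p : ℝ) (hp : p ∈ Set.Ioo (0 : ℝ) 1) (e : Sym2 (Vertex d)) (he : IsNNEdge e) :
    ((∀ f, IsNNEdge f → (openEdge κ U p f ↔ openEdge κ (Function.update U e 0) p f)) ∨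
      (∀ f, IsNNEdge f → (openEdge κ U p f ↔ openEdge κ (Function.update U e 1) p f))) ∧
    ∃ (m i : ℕ) (x : ℕ → Vertex d), 0 < m ∧ i < m ∧
      (∀ j < m, adj (x j) (x (j + 1))) ∧
      e = s(x i, x (i + 1)) ∧
      -- the vertices are distinct, except that the two endpoints may coincide
      (∀ j ≤ m, ∀ j' ≤ m, x j = x j' → j = j' ∨ (j = 0 ∧ j' = m) ∨ (j = m ∧ j' = 0)) ∧
      -- the edges are pairwise distinct
      (∀ j < m, ∀ j' < m, s(x j, x (j + 1)) = s(x j', x (j' + 1)) → j = j') ∧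
      -- the switching path is exactly the set of edges where the two configurations differ
      {f : Sym2 (Vertex d) | IsNNEdge f ∧
          ¬ (openEdge κ (Function.update U e 0) p f ↔ openEdge κ (Function.update U e 1) p f)}
        = {f | ∃ j < m, f = s(x j, x (j + 1))} ∧
      -- the half-path `x 0, …, x i` is decreasing
      (∀ j < i, U s(x j, x (j + 1)) ≤ p) ∧
      (∀ j, j + 1 < i → U s(x (j + 1), x (j + 2)) < U s(x j, x (j + 1))) ∧
      -- the half-path `x m, …, x (i+1)` is decreasing
      (∀ j, i < j → j < m → U s(x j, x (j + 1)) ≤ p) ∧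
      (∀ j, i + 1 ≤ j → j + 1 < m → U s(x j, x (j + 1)) < U s(x (j + 1), x (j + 2))) := by
  obtain ⟨-, hinj, hwalk⟩ := hU
  have hdown : NoDescendingWalk U := fun ⟨w, h1, h2⟩ => hwalk ⟨w, h1, .inr h2⟩
  have hup : NoDescendingWalk (-U) := fun ⟨w, h1, h2⟩ =>
    hwalk ⟨w, h1, .inl fun i j hij => neg_lt_neg_iff.1 (h2 hij)⟩
  have hdown' : ∀ c, NoDescendingWalk (Function.update U e c) := fun c =>
    hdown.of_eq_off fun f hf => Function.update_of_ne hf _ _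
  have hup' : NoDescendingWalk (-Function.update U e 0) :=
    hup.of_eq_off fun f hf => congrArg Neg.neg (Function.update_of_ne hf _ _)
  have hκ : 0 < κ := by omega
  obtain ⟨ρ, hρ⟩ := exists_consistent κ hdown
  obtain ⟨s, hs⟩ := exists_consistent κ (hdown' 0)
  obtain ⟨t, ht⟩ := exists_consistent κ (hdown' 1)
  constructor
  · by_cases hep : U e ≤ p
    · by_cases hρe : ρ e
      · left
        intro f hf
        rw [openEdge_iff_s2 hdown hρ hf, openEdge_iff_s2 (hdown' 0)
          (hρ.update_zero hκ (fun f hf => (hU01 f hf).1)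
            (fun f hf hfe h => hfe (hinj f e hf he h)) he hρe) hf]
        by_cases hfe : f = e
        · subst hfe
          simp [hep, hp.1.le]
        · rw [Function.update_of_ne hfe]
      · right
        obtain ⟨ρ', hρ', heq⟩ := hρ.exists_update_one (fun f hf => (hU01 f hf).2) hρe
        intro f hf
        rw [openEdge_iff_s2 hdown hρ hf, openEdge_iff_s2 (hdown' 1) hρ' hf]
        by_cases hfe : f = e
        · subst hfe
          simp [hρe, hp.2]
        · rw [Function.update_of_ne hfe, heq f hfe]
    · right
      intro f hf
      rw [openEdge_iff_s2 hdown hρ hf, openEdge_iff_s2 (hdown' 1) ht hf]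
      by_cases hfe : f = e
      · subst hfe
        simp [hep, hp.2]
      · rw [Function.update_of_ne hfe]
        refine and_congr_right fun hfp => hρ.iff_of_agree hdown (p := p) ?_ ht hf hfp
        intro g _ hg
        by_cases hge : g = e
        · subst hge
          rcases hg with hg | hg
          · exact absurd hg hep
          · rw [Function.update_self] at hg
            exact absurd hp.2 hg.not_gt
        · rw [Function.update_of_ne hge]
  · have hc := coupled_update hκ hU01 hinj he hs ht
    obtain ⟨x₀, y₀, -, hxy⟩ := he
    have hep : Function.update U e 0 e ≤ p := by
      rw [Function.update_self]
      exact hp.1.le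
    obtain ⟨A, B, l, r, harm, hall⟩ :=
      (hc.isArmPair_start hep hxy).exists_complete hc (hdown' 0) hup'
    obtain ⟨m, i, x, hm, hi, hadj, hei, hvert, hedge, hset, hl₁, hl₂, hr₁, hr₂⟩ :=
      harm.exists_path hall
    have hlab : ∀ j < m, j ≠ i →
        Function.update U e 0 s(x j, x (j + 1)) = U s(x j, x (j + 1)) := fun j hj hji =>
      Function.update_of_ne (fun h => hji (hedge j hj i hi (h.trans hei))) _ _
    refine ⟨m, i, x, hm, hi, hadj, hei, hvert, hedge, ?_, fun j hj => ?_, fun j hj => ?_,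
      fun j hj hjm => ?_, fun j hj hjm => ?_⟩
    · rw [← hset]
      ext f
      simp only [Set.mem_ofPred_eq, Discrepant]
      refine and_congr_right fun hf => ?_
      rw [openEdge_iff_s2 (hdown' 0) hs hf, openEdge_iff_s2 (hdown' 1) ht hf]
      by_cases hfe : f = e
      · subst hfe
        have := hc.open_true
        simp only [if_true] at this
        simp [hp.1.le, hp.2, this]
      · simp only [Function.update_of_ne hfe, Bool.exists_bool]
        simp [hfe]
        tauto
    · rw [← hlab j (by omega) (by omega)]
      exact hl₁ j hj
    · rw [← hlab j (by omega) (by omega), ← hlab (j + 1) (by omega) (by omega)]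
      exact hl₂ j hj
    · rw [← hlab j (by omega) (by omega)]
      exact hr₁ j hj hjm
    · rw [← hlab j (by omega) (by omega), ← hlab (j + 1) (by omega) (by omega)]
      exact hr₂ j hj hjm

end CDP
end
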